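/- arXiv:1102.3860 — 3 statements merged into one kernel-verified Lean document; each statement's English description precedes it below -/
import Mathlib

section
/- Let n ≥ 2 and x₀ ∈ ℝ^n, and define p(r) := P_γ(B_r(x₀)) for r ≥ 0, where B_r(x₀) is the open ball of radius r centered at x₀. Then p(r) < ∞ for every r ≥ 0, p is continuous on [0,∞), lim_{r→0⁺} p(r) = 0 and lim_{r→∞} p(r) = 0; moreover there exist 0 < r_m < r_M (depending on x₀ and n) such that p is monotone increasing on [0, r_m] and monotone decreasing on [r_M, ∞). -/
open MeasureTheory Real Filter
open scoped RealInnerProductSpace ENNReal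

/-- The standard Gaussian measure `γ_n` on `ℝ^n`, with density
`(2π)^{-n/2} exp(-‖x‖²/2)` with respect to Lebesgue measure. -/
noncomputable def gaussianMeasure (n : ℕ) : Measure (EuclideanSpace ℝ (Fin n)) :=
  (volume : Measure (EuclideanSpace ℝ (Fin n))).withDensity fun x =>
    ENNReal.ofReal ((2 * π) ^ (-(n : ℝ) / 2) * Real.exp (-‖x‖ ^ 2 / 2))

/-- The Gaussian divergence `div_γ φ(x) = div φ(x) − ⟨x, φ(x)⟩` of a vector field. -/
noncomputable def gdiv (n : ℕ) (φ : EuclideanSpace ℝ (Fin n) → EuclideanSpace ℝ (Fin n))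
    (x : EuclideanSpace ℝ (Fin n)) : ℝ :=
  (∑ i : Fin n, fderiv ℝ φ x (EuclideanSpace.single i 1) i) - ⟪x, φ x⟫

/-- A vector field is admissible if it is `C¹`, bounded with bounded derivative,
and satisfies `‖φ(x)‖ ≤ 1` for all `x`. -/
def Admissible (n : ℕ) (φ : EuclideanSpace ℝ (Fin n) → EuclideanSpace ℝ (Fin n)) : Prop :=
  ContDiff ℝ 1 φ ∧ (∃ M, ∀ x, ‖fderiv ℝ φ x‖ ≤ M) ∧ ∀ x, ‖φ x‖ ≤ 1

/-- The Gaussian total variation `V_γ(u) = sup {∫ u · div_γ φ dγ_n : φ admissible}`. -/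
noncomputable def totVar (n : ℕ) (u : EuclideanSpace ℝ (Fin n) → ℝ) : ℝ≥0∞ :=
  ⨆ (φ : EuclideanSpace ℝ (Fin n) → EuclideanSpace ℝ (Fin n)) (_ : Admissible n φ),
    ENNReal.ofReal (∫ x, u x * gdiv n φ x ∂(gaussianMeasure n))

/-- The Gaussian perimeter `P_γ(E) = V_γ(χ_E)` of a set `E ⊆ ℝⁿ`. -/
noncomputable def gPerimeter (n : ℕ) (E : Set (EuclideanSpace ℝ (Fin n))) : ℝ≥0∞ :=
  totVar n (E.indicator fun _ => 1)

section Polar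
variable {E : Type*} [NormedAddCommGroup E] [NormedSpace ℝ E] [MeasurableSpace E] [BorelSpace E]
  [FiniteDimensional ℝ E]

/-- Integration in polar coordinates. -/
theorem integral_eq_integral_Ioi_toSphere [Nontrivial E] (μ : Measure E)
    [μ.IsAddHaarMeasure] {f : E → ℝ} (hf : Integrable f μ) :
    ∫ x, f x ∂μ = ∫ s in Set.Ioi (0 : ℝ), s ^ (Module.finrank ℝ E - 1) *
      ∫ θ : Metric.sphere (0 : E) 1, f (s • (θ : E)) ∂μ.toSphere := by
  have hemb : MeasurableEmbedding ((↑) : ({(0)}ᶜ : Set E) → E) :=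
    MeasurableEmbedding.subtype_coe (measurableSet_singleton _).compl
  let g : Metric.sphere (0 : E) 1 × Set.Ioi (0 : ℝ) → ℝ := fun p => f (p.2.1 • (p.1 : E))
  have hmp := μ.measurePreserving_homeomorphUnitSphereProd
  have hg : ∀ x : ({(0)}ᶜ : Set E), g (homeomorphUnitSphereProd E x) = f x := by
    intro x
    have hx : ‖(x : E)‖ ≠ 0 := norm_ne_zero_iff.2 x.2
    simp [g, smul_smul, hx]
  have hint : Integrable g (μ.toSphere.prod (Measure.volumeIoiPow (Module.finrank ℝ E - 1))) := by
    rw [← hmp.integrable_comp_emb (Homeomorph.measurableEmbedding _)]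
    have : g ∘ homeomorphUnitSphereProd E = f ∘ (↑) := funext hg
    rw [this, ← integrableOn_iff_comap_subtypeVal (measurableSet_singleton _).compl]
    exact hf.integrableOn
  calc
    ∫ x, f x ∂μ = ∫ x : ({(0)}ᶜ : Set E), f x ∂(μ.comap (↑)) := by
      rw [integral_subtype_comap (measurableSet_singleton _).compl f,
        restrict_compl_singleton]
    _ = ∫ p, g p ∂μ.toSphere.prod (.volumeIoiPow (Module.finrank ℝ E - 1)) := by
      rw [← hmp.integral_comp (Homeomorph.measurableEmbedding _)]
      simp only [hg]
    _ = ∫ s : Set.Ioi (0 : ℝ), ∫ θ : Metric.sphere (0 : E) 1, f (s.1 • (θ : E)) ∂μ.toSphere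
          ∂(.volumeIoiPow (Module.finrank ℝ E - 1)) := integral_prod_symm _ hint
    _ = _ := by
      simp only [Measure.volumeIoiPow, ENNReal.ofReal]
      rw [integral_withDensity_eq_integral_smul,
        integral_subtype_comap measurableSet_Ioi fun a : ℝ ↦
          Real.toNNReal (a ^ (Module.finrank ℝ E - 1)) •
            ∫ θ : Metric.sphere (0 : E) 1, f (a • (θ : E)) ∂μ.toSphere]
      · refine setIntegral_congr_fun measurableSet_Ioi fun x hx ↦ ?_
        rw [NNReal.smul_def, Real.coe_toNNReal _ (pow_nonneg (le_of_lt hx) _), smul_eq_mul]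
      · exact (measurable_subtype_coe.pow_const _).real_toNNReal

theorem continuous_integral_toSphere (μ : Measure E) [μ.IsAddHaarMeasure]
    {f : ℝ → Metric.sphere (0 : E) 1 → ℝ} (hf : Continuous f.uncurry) :
    Continuous fun s => ∫ θ, f s θ ∂μ.toSphere := by
  have : ProperSpace E := FiniteDimensional.proper ℝ E
  simpa using continuous_parametric_integral_of_continuous (μ := μ.toSphere) hf
    isCompact_univ

end Polar

section Divergence
variable {n : ℕ}

/-- The divergence of a vector field on `ℝⁿ`. -/
noncomputable def divergence (G : EuclideanSpace ℝ (Fin n) → EuclideanSpace ℝ (Fin n))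
    (x : EuclideanSpace ℝ (Fin n)) : ℝ :=
  ∑ i : Fin n, fderiv ℝ G x (EuclideanSpace.single i 1) i

theorem continuous_divergence {G : EuclideanSpace ℝ (Fin n) → EuclideanSpace ℝ (Fin n)}
    (hG : ContDiff ℝ 1 G) : Continuous (divergence G) := by
  have h := hG.continuous_fderiv one_ne_zero
  unfold divergence
  refine continuous_finsetSum _ fun i _ => ?_
  have : Continuous fun x => fderiv ℝ G x (EuclideanSpace.single i 1) := by fun_prop
  fun_prop

theorem integral_mul_divergence {G : EuclideanSpace ℝ (Fin n) → EuclideanSpace ℝ (Fin n)}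
    (hG : ContDiff ℝ 1 G) {χ : EuclideanSpace ℝ (Fin n) → ℝ} (hχ : ContDiff ℝ 1 χ)
    (hc : HasCompactSupport χ) :
    ∫ x, χ x * divergence G x = - ∫ x, fderiv ℝ χ x (G x) := by
  have h1 : ∀ i : Fin n, ∀ x, fderiv ℝ G x (EuclideanSpace.single i 1) i =
      fderiv ℝ (fun y => G y i) x (EuclideanSpace.single i 1) := by
    intro i x
    have h := (EuclideanSpace.proj (𝕜 := ℝ) i).hasFDerivAt.comp x
      ((hG.differentiable one_ne_zero) x).hasFDerivAt
    exact (congrArg (fun L => L (EuclideanSpace.single i 1)) h.fderiv).symm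
  have hGi : ∀ i : Fin n, ContDiff ℝ 1 (fun y => G y i) := fun i => contDiff_euclidean.1 hG i
  have hd := hχ.continuous_fderiv one_ne_zero
  have hdi : ∀ i : Fin n, Continuous fun x => fderiv ℝ χ x (EuclideanSpace.single i 1) := by
    intro i; fun_prop
  have hdci : ∀ i : Fin n, HasCompactSupport
      fun x => fderiv ℝ χ x (EuclideanSpace.single i 1) := fun i => hc.fderiv_apply ℝ _
  have hI1 : ∀ i : Fin n, Integrable fun x =>
      χ x * fderiv ℝ (fun y => G y i) x (EuclideanSpace.single i 1) := by
    intro i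
    have := (hGi i).continuous_fderiv one_ne_zero
    have h2 : Continuous fun x => fderiv ℝ (fun y => G y i) x (EuclideanSpace.single i 1) := by
      fun_prop
    exact (hχ.continuous.mul h2).integrable_of_hasCompactSupport hc.mul_right
  have hI2 : ∀ i : Fin n, Integrable fun x =>
      fderiv ℝ χ x (EuclideanSpace.single i 1) * G x i := fun i =>
    ((hdi i).mul (hGi i).continuous).integrable_of_hasCompactSupport (hdci i).mul_right
  have hI3 : ∀ i : Fin n, Integrable fun x => χ x * G x i := fun i =>
    (hχ.continuous.mul (hGi i).continuous).integrable_of_hasCompactSupport hc.mul_right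
  have h2 : ∀ x, fderiv ℝ χ x (G x) =
      ∑ i, fderiv ℝ χ x (EuclideanSpace.single i 1) * G x i := by
    intro x
    conv_lhs => rw [← (EuclideanSpace.basisFun (Fin n) ℝ).sum_repr (G x)]
    simp [map_sum, mul_comm]
  simp only [h2, divergence, h1, Finset.mul_sum]
  rw [integral_finsetSum _ fun i _ => hI1 i, integral_finsetSum _ fun i _ => hI2 i,
    ← Finset.sum_neg_distrib]
  refine Finset.sum_congr rfl fun i _ => ?_
  exact integral_mul_fderiv_eq_neg_fderiv_mul_of_integrable (hI2 i) (hI1 i) (hI3 i)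
    (fun x _ => hχ.differentiable one_ne_zero x) (fun x _ => (hGi i).differentiable one_ne_zero x)

theorem integral_test_mul_eq [Nontrivial (EuclideanSpace ℝ (Fin n))]
    {G : EuclideanSpace ℝ (Fin n) → EuclideanSpace ℝ (Fin n)} (hG : ContDiff ℝ 1 G)
    {g : ℝ → ℝ} (hg : Continuous g) (hgc : HasCompactSupport g) (hgs : tsupport g ⊆ Set.Ioi 0) :
    ∫ s, g s * ((∫ t in (0 : ℝ)..s, t ^ (n - 1) *
          ∫ θ : Metric.sphere (0 : EuclideanSpace ℝ (Fin n)) 1,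
            divergence G (t • (θ : EuclideanSpace ℝ (Fin n))) ∂volume.toSphere) -
        s ^ (n - 1) * ∫ θ : Metric.sphere (0 : EuclideanSpace ℝ (Fin n)) 1,
          ⟪G (s • (θ : EuclideanSpace ℝ (Fin n))), (θ : EuclideanSpace ℝ (Fin n))⟫
            ∂volume.toSphere) = 0 := by
  set j : ℝ → ℝ := fun t => t ^ (n - 1) *
          ∫ θ : Metric.sphere (0 : EuclideanSpace ℝ (Fin n)) 1,
            divergence G (t • (θ : EuclideanSpace ℝ (Fin n))) ∂volume.toSphere with hj
  set Ψ : ℝ → ℝ := fun s => s ^ (n - 1) * ∫ θ : Metric.sphere (0 : EuclideanSpace ℝ (Fin n)) 1,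
          ⟪G (s • (θ : EuclideanSpace ℝ (Fin n))), (θ : EuclideanSpace ℝ (Fin n))⟫
            ∂volume.toSphere with hΨ
  have hjc : Continuous j := by
    have := continuous_divergence hG
    exact (continuous_pow _).mul (continuous_integral_toSphere _ (by
      unfold Function.uncurry; fun_prop))
  have hΨc : Continuous Ψ := by
    have := hG.continuous
    exact (continuous_pow _).mul (continuous_integral_toSphere _ (by
      unfold Function.uncurry; fun_prop))
  obtain ⟨R, hR0, hR⟩ : ∃ R, 0 < R ∧ ∀ s, R ≤ s → g s = 0 := by
    obtain ⟨R, hR⟩ := hgc.isCompact.bddAbove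
    refine ⟨max R 0 + 1, by positivity, fun s hs => image_eq_zero_of_notMem_tsupport fun h => ?_⟩
    have := hR h
    linarith [le_max_left R 0]
  have hneg : ∀ s ≤ 0, g s = 0 := fun s hs =>
    image_eq_zero_of_notMem_tsupport fun h => absurd (hgs h) (by simpa using hs)
  set K : ℝ → ℝ := fun s => ∫ t in R..s, g t with hK
  have hKd : ∀ s, HasDerivAt K (g s) s := fun s => hg.integral_hasStrictDerivAt R s |>.hasDerivAt
  have hKR : ∀ s, R ≤ s → K s = 0 := by
    intro s hs
    rw [hK]
    simp only
    rw [intervalIntegral.integral_congr (g := fun _ => 0), intervalIntegral.integral_zero]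
    intro t ht
    rw [Set.uIcc_of_le hs] at ht
    exact hR t ht.1
  have hKC : ContDiff ℝ 1 K := by
    rw [contDiff_one_iff_deriv]
    refine ⟨fun s => (hKd s).differentiableAt, ?_⟩
    rwa [show deriv K = g from funext fun s => (hKd s).deriv]
  have hK0 : ∀ᶠ s in nhds 0, K s = K 0 := by
    have h0 : (0 : ℝ) ∉ tsupport g := fun h => lt_irrefl (0 : ℝ) (hgs h)
    have h1 : ∀ᶠ s in nhds (0 : ℝ), g s = 0 := notMem_tsupport_iff_eventuallyEq.1 h0
    obtain ⟨δ, hδ, h1⟩ := Metric.eventually_nhds_iff_ball.1 h1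
    filter_upwards [Metric.ball_mem_nhds 0 hδ] with s hs
    have : K s - K 0 = ∫ t in (0 : ℝ)..s, g t :=
      intervalIntegral.integral_interval_sub_left (hg.intervalIntegrable _ _)
        (hg.intervalIntegrable _ _)
    rw [← sub_eq_zero, this, intervalIntegral.integral_congr (g := fun _ => 0),
      intervalIntegral.integral_zero]
    intro t ht
    refine h1 t ?_
    have hconv := (convex_ball (0 : ℝ) δ).segment_subset (Metric.mem_ball_self hδ) hs
    rw [segment_eq_uIcc] at hconv
    exact hconv ht
  set χ : EuclideanSpace ℝ (Fin n) → ℝ := fun y => K ‖y‖ with hχ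
  have hχC : ContDiff ℝ 1 χ := by
    rw [contDiff_iff_contDiffAt]
    intro y
    by_cases hy : y = 0
    · have : χ =ᶠ[nhds y] fun _ => K 0 := by
        have ht : Tendsto (fun z : EuclideanSpace ℝ (Fin n) => ‖z‖) (nhds y) (nhds 0) := by
          have := (continuous_norm (E := EuclideanSpace ℝ (Fin n))).tendsto y
          rwa [hy, norm_zero, ← hy] at this
        exact ht.eventually hK0
      exact contDiffAt_const.congr_of_eventuallyEq this
    · exact hKC.contDiffAt.comp y (contDiffAt_norm ℝ hy)
  have hχc : HasCompactSupport χ := by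
    refine HasCompactSupport.intro (isCompact_closedBall 0 R) fun y hy => hKR _ ?_
    simp at hy
    exact hy.le
  have hχd : ∀ s : ℝ, 0 < s → ∀ θ : Metric.sphere (0 : EuclideanSpace ℝ (Fin n)) 1,
      ∀ v, fderiv ℝ χ (s • (θ : EuclideanSpace ℝ (Fin n))) v
        = g s * ⟪v, (θ : EuclideanSpace ℝ (Fin n))⟫ := by
    intro s hs θ v
    have hθ : ‖(θ : EuclideanSpace ℝ (Fin n))‖ = 1 := by simp
    have hn : ‖s • (θ : EuclideanSpace ℝ (Fin n))‖ = s := by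
      rw [norm_smul, hθ, Real.norm_of_nonneg hs.le, mul_one]
    have hne : s • (θ : EuclideanSpace ℝ (Fin n)) ≠ 0 := by
      rw [← norm_ne_zero_iff, hn]; exact hs.ne'
    have h1 := (hasStrictFDerivAt_norm_sq (s • (θ : EuclideanSpace ℝ (Fin n)))).hasFDerivAt.sqrt
      (by positivity)
    simp only [Real.sqrt_sq (norm_nonneg _)] at h1
    have h2 := (hKd _).comp_hasFDerivAt _ h1
    have h3 : HasFDerivAt χ _ _ := h2
    rw [h3.fderiv, hn]
    simp only [smul_apply, map_smul, smul_eq_mul, nsmul_eq_mul, innerSL_apply_apply]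
    rw [real_inner_comm]
    field_simp
    norm_num
  have key := integral_mul_divergence hG hχC hχc
  have hi1 : Integrable fun y => χ y * divergence G y :=
    (hχC.continuous.mul (continuous_divergence hG)).integrable_of_hasCompactSupport hχc.mul_right
  have hi2 : Integrable fun y => fderiv ℝ χ y (G y) := by
    have hc := hχC.continuous_fderiv one_ne_zero
    have hGc := hG.continuous
    refine (hc.clm_apply hGc).integrable_of_hasCompactSupport ?_
    refine (hχc.fderiv ℝ).mono' ?_
    refine subset_trans (fun y hy => ?_) (subset_tsupport _)
    rw [Function.mem_support] at hy ⊢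
    contrapose! hy
    simp [hy]
  rw [integral_eq_integral_Ioi_toSphere volume hi1, integral_eq_integral_Ioi_toSphere volume hi2]
    at key
  simp only [finrank_euclideanSpace, Fintype.card_fin] at key
  have cut : ∀ F : ℝ → ℝ, (∀ s, R ≤ s → F s = 0) →
      ∫ s in Set.Ioi (0 : ℝ), F s = ∫ s in (0 : ℝ)..R, F s := by
    intro F hF
    rw [intervalIntegral.integral_of_le hR0.le]
    refine (setIntegral_eq_of_subset_of_forall_sdiff_eq_zero measurableSet_Ioi
      (fun s hs => hs.1) fun s hs => hF s ?_)
    by_contra h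
    exact hs.2 ⟨hs.1, (not_le.1 h).le⟩
  have e1 : ∫ s in Set.Ioi (0 : ℝ), s ^ (n - 1) *
      ∫ θ : Metric.sphere (0 : EuclideanSpace ℝ (Fin n)) 1,
        χ (s • (θ : EuclideanSpace ℝ (Fin n))) *
          divergence G (s • (θ : EuclideanSpace ℝ (Fin n))) ∂volume.toSphere =
      ∫ s in (0 : ℝ)..R, K s * j s := by
    rw [← cut _ fun s hs => by rw [hKR s hs, zero_mul]]
    refine setIntegral_congr_fun measurableSet_Ioi fun s hs => ?_
    have hs : 0 < s := hs
    have hs2 : ∀ θ : Metric.sphere (0 : EuclideanSpace ℝ (Fin n)) 1,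
        χ (s • (θ : EuclideanSpace ℝ (Fin n))) = K s := by
      intro θ
      have hθ : ‖(θ : EuclideanSpace ℝ (Fin n))‖ = 1 := by simp
      simp [hχ, norm_smul, hθ, abs_of_pos hs]
    simp only [hs2, integral_const_mul, hj]
    ring
  have e2 : ∫ s in Set.Ioi (0 : ℝ), s ^ (n - 1) *
      ∫ θ : Metric.sphere (0 : EuclideanSpace ℝ (Fin n)) 1,
        fderiv ℝ χ (s • (θ : EuclideanSpace ℝ (Fin n))) (G (s • (θ : EuclideanSpace ℝ (Fin n))))
          ∂volume.toSphere =
      ∫ s in (0 : ℝ)..R, g s * Ψ s := by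
    rw [← cut _ fun s hs => by rw [hR s hs, zero_mul]]
    refine setIntegral_congr_fun measurableSet_Ioi fun s hs => ?_
    have hs : 0 < s := hs
    simp only [hχd s hs, integral_const_mul, hΨ]
    ring
  rw [e1, e2] at key
  set J : ℝ → ℝ := fun s => ∫ t in (0 : ℝ)..s, j t with hJ
  have hJd : ∀ s, HasDerivAt J (j s) s := fun s => hjc.integral_hasStrictDerivAt 0 s |>.hasDerivAt
  have hJc : Continuous J := continuous_iff_continuousAt.2 fun s => (hJd s).continuousAt
  rw [intervalIntegral.integral_mul_deriv_eq_deriv_mul (fun s _ => hKd s) (fun s _ => hJd s)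
    (hg.intervalIntegrable _ _) (hjc.intervalIntegrable _ _), hKR R le_rfl,
    show J 0 = 0 from intervalIntegral.integral_same] at key
  have e3 : ∫ s, g s * (J s - Ψ s) = ∫ s in (0 : ℝ)..R, g s * (J s - Ψ s) := by
    rw [← cut _ fun s hs => by rw [hR s hs, zero_mul]]
    refine (setIntegral_eq_integral_of_forall_compl_eq_zero fun s hs => ?_).symm
    rw [hneg s (by simpa using hs), zero_mul]
  change ∫ s, g s * (J s - Ψ s) = 0
  rw [e3]
  simp only [mul_sub]
  have e4 := intervalIntegral.integral_sub ((hg.mul hJc).intervalIntegrable (μ := volume) 0 R)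
    ((hg.mul hΨc).intervalIntegrable 0 R)
  simp only [Pi.mul_apply] at e4
  rw [e4]
  linarith

/-- The divergence theorem on a ball centered at the origin. -/
theorem setIntegral_ball_divergence [Nontrivial (EuclideanSpace ℝ (Fin n))]
    {G : EuclideanSpace ℝ (Fin n) → EuclideanSpace ℝ (Fin n)} (hG : ContDiff ℝ 1 G)
    {r : ℝ} (hr : 0 < r) :
    ∫ x in Metric.ball 0 r, divergence G x =
      r ^ (n - 1) * ∫ θ : Metric.sphere (0 : EuclideanSpace ℝ (Fin n)) 1,
          ⟪G (r • (θ : EuclideanSpace ℝ (Fin n))), (θ : EuclideanSpace ℝ (Fin n))⟫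
            ∂volume.toSphere := by
  set j : ℝ → ℝ := fun t => t ^ (n - 1) *
          ∫ θ : Metric.sphere (0 : EuclideanSpace ℝ (Fin n)) 1,
            divergence G (t • (θ : EuclideanSpace ℝ (Fin n))) ∂volume.toSphere with hj
  set Ψ : ℝ → ℝ := fun s => s ^ (n - 1) * ∫ θ : Metric.sphere (0 : EuclideanSpace ℝ (Fin n)) 1,
          ⟪G (s • (θ : EuclideanSpace ℝ (Fin n))), (θ : EuclideanSpace ℝ (Fin n))⟫
            ∂volume.toSphere with hΨ
  have hjc : Continuous j := by
    have := continuous_divergence hG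
    exact (continuous_pow _).mul (continuous_integral_toSphere _ (by
      unfold Function.uncurry; fun_prop))
  have hΨc : Continuous Ψ := by
    have := hG.continuous
    exact (continuous_pow _).mul (continuous_integral_toSphere _ (by
      unfold Function.uncurry; fun_prop))
  have hJc : Continuous fun s => ∫ t in (0 : ℝ)..s, j t :=
    intervalIntegral.continuous_primitive (fun a b => hjc.intervalIntegrable a b) 0
  have hae := isOpen_Ioi.ae_eq_zero_of_integral_contDiff_smul_eq_zero (μ := volume)
    (f := fun s => (∫ t in (0 : ℝ)..s, j t) - Ψ s) (U := Set.Ioi (0 : ℝ))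
    ((hJc.sub hΨc).locallyIntegrable.locallyIntegrableOn _)
    (fun g hg hgc hgs => integral_test_mul_eq hG hg.continuous hgc hgs)
  have heq : (∫ t in (0 : ℝ)..r, j t) - Ψ r = 0 :=
    Measure.eqOn_open_of_ae_eq (μ := volume) (g := fun _ => 0)
      ((ae_restrict_iff' measurableSet_Ioi).2 hae) isOpen_Ioi
      (hJc.sub hΨc).continuousOn continuousOn_const hr
  change _ = Ψ r
  rw [← sub_eq_zero.1 heq, intervalIntegral.integral_of_le hr.le, integral_Ioc_eq_integral_Ioo,
    ← integral_indicator measurableSet_ball, integral_eq_integral_Ioi_toSphere volume]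
  · rw [setIntegral_eq_of_subset_of_forall_sdiff_eq_zero measurableSet_Ioi
      (s := Set.Ioo 0 r) (fun s hs => hs.1)]
    · refine setIntegral_congr_fun measurableSet_Ioo fun s hs => ?_
      have : ∀ θ : Metric.sphere (0 : EuclideanSpace ℝ (Fin n)) 1,
          s • (θ : EuclideanSpace ℝ (Fin n)) ∈ Metric.ball 0 r := by
        intro θ
        have hθ : ‖(θ : EuclideanSpace ℝ (Fin n))‖ = 1 := by simp
        simp [norm_smul, hθ, abs_of_pos hs.1, hs.2]
      simp [hj, this, Set.indicator_of_mem]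
    · intro s hs
      have : ∀ θ : Metric.sphere (0 : EuclideanSpace ℝ (Fin n)) 1,
          s • (θ : EuclideanSpace ℝ (Fin n)) ∉ Metric.ball 0 r := by
        intro θ h
        have hθ : ‖(θ : EuclideanSpace ℝ (Fin n))‖ = 1 := by simp
        have hs0 : 0 < s := hs.1
        simp [norm_smul, hθ, abs_of_pos hs0] at h
        exact hs.2 ⟨hs0, h⟩
      simp [this, Set.indicator_of_notMem]
  · rw [integrable_indicator_iff measurableSet_ball]
    exact ((continuous_divergence hG).continuousOn.integrableOn_compact
      (isCompact_closedBall 0 r)).mono_set Metric.ball_subset_closedBall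
end Divergence

section Gaussian
variable {n : ℕ}

/-- The density of the standard Gaussian measure. -/
noncomputable def gaussianDensity (n : ℕ) (x : EuclideanSpace ℝ (Fin n)) : ℝ :=
  (2 * π) ^ (-(n : ℝ) / 2) * Real.exp (-‖x‖ ^ 2 / 2)

theorem gaussianDensity_nonneg (x : EuclideanSpace ℝ (Fin n)) : 0 ≤ gaussianDensity n x := by
  unfold gaussianDensity; positivity

theorem contDiff_gaussianDensity : ContDiff ℝ 1 (gaussianDensity n) := by
  unfold gaussianDensity
  have := contDiff_norm_sq ℝ (E := EuclideanSpace ℝ (Fin n)) (n := 1)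
  fun_prop

theorem continuous_gaussianDensity : Continuous (gaussianDensity n) :=
  contDiff_gaussianDensity.continuous

theorem fderiv_gaussianDensity (x v : EuclideanSpace ℝ (Fin n)) :
    fderiv ℝ (gaussianDensity n) x v = -⟪x, v⟫ * gaussianDensity n x := by
  have h := ((((hasStrictFDerivAt_norm_sq x).hasFDerivAt.neg).mul_const (2⁻¹ : ℝ)).exp).const_mul
    ((2 * π) ^ (-(n : ℝ) / 2))
  have h' : HasFDerivAt (gaussianDensity n) _ x := h
  rw [h'.fderiv]
  simp only [smul_apply, smul_eq_mul, nsmul_eq_mul, innerSL_apply_apply, neg_apply,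
    gaussianDensity, Pi.neg_apply, div_eq_mul_inv]
  push_cast
  ring

theorem divergence_gaussianDensity_smul
    {φ : EuclideanSpace ℝ (Fin n) → EuclideanSpace ℝ (Fin n)} (hφ : ContDiff ℝ 1 φ)
    (x : EuclideanSpace ℝ (Fin n)) :
    divergence (fun y => gaussianDensity n y • φ y) x = gaussianDensity n x * gdiv n φ x := by
  unfold divergence gdiv
  rw [fderiv_fun_smul (contDiff_gaussianDensity.differentiable one_ne_zero x)
    (hφ.differentiable one_ne_zero x)]
  simp only [add_apply, smul_apply, ContinuousLinearMap.smulRight_apply, PiLp.add_apply,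
    PiLp.smul_apply, smul_eq_mul, fderiv_gaussianDensity, EuclideanSpace.inner_single_right,
    Finset.sum_add_distrib, ← Finset.mul_sum, mul_sub, PiLp.inner_apply (𝕜 := ℝ) x (φ x)]
  rw [sub_eq_add_neg, Finset.mul_sum Finset.univ (fun i => ⟪x i, φ x i⟫), ← Finset.sum_neg_distrib]
  congr 1
  refine Finset.sum_congr rfl fun i _ => ?_
  simp
  ring

theorem integral_ball_gdiv [Nontrivial (EuclideanSpace ℝ (Fin n))]
    {φ : EuclideanSpace ℝ (Fin n) → EuclideanSpace ℝ (Fin n)} (hφ : ContDiff ℝ 1 φ)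
    (x₀ : EuclideanSpace ℝ (Fin n)) {r : ℝ} (hr : 0 < r) :
    ∫ x, (Metric.ball x₀ r).indicator (fun _ => (1 : ℝ)) x * gdiv n φ x ∂(gaussianMeasure n) =
      r ^ (n - 1) * ∫ θ : Metric.sphere (0 : EuclideanSpace ℝ (Fin n)) 1,
        gaussianDensity n (x₀ + r • (θ : EuclideanSpace ℝ (Fin n))) *
          ⟪φ (x₀ + r • (θ : EuclideanSpace ℝ (Fin n))), (θ : EuclideanSpace ℝ (Fin n))⟫
            ∂volume.toSphere := by
  have hF : ContDiff ℝ 1 (fun y => gaussianDensity n y • φ y) := contDiff_gaussianDensity.smul hφ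
  have hG : ContDiff ℝ 1 (fun y => gaussianDensity n (x₀ + y) • φ (x₀ + y)) :=
    hF.comp (contDiff_const.add contDiff_id)
  have hdiv : ∀ y, divergence (fun y => gaussianDensity n (x₀ + y) • φ (x₀ + y)) y =
      gaussianDensity n (x₀ + y) * gdiv n φ (x₀ + y) := by
    intro y
    rw [← divergence_gaussianDensity_smul hφ]
    unfold divergence
    rw [fderiv_comp_add_left (f := fun y => gaussianDensity n y • φ y) x₀]
  have hm : Measurable fun x : EuclideanSpace ℝ (Fin n) => (gaussianDensity n x).toNNReal :=
    continuous_gaussianDensity.measurable.real_toNNReal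
  have key := setIntegral_ball_divergence hG hr
  simp only [inner_smul_left, conj_trivial] at key
  rw [← key, ← integral_indicator measurableSet_ball]
  have e : gaussianMeasure n = volume.withDensity fun x => ((gaussianDensity n x).toNNReal : ℝ≥0∞) :=
    rfl
  rw [e, integral_withDensity_eq_integral_smul hm, ← integral_add_left_eq_self _ x₀]
  refine integral_congr_ae (Eventually.of_forall fun y => ?_)
  simp only [NNReal.smul_def, Real.coe_toNNReal _ (gaussianDensity_nonneg _), smul_eq_mul]
  by_cases hy : ‖y‖ < r
  · rw [Set.indicator_of_mem (by simpa using hy), Set.indicator_of_mem (by simpa using hy), hdiv,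
      one_mul]
  · rw [Set.indicator_of_notMem (by simpa using hy), Set.indicator_of_notMem (by simpa using hy),
      zero_mul, mul_zero]

/-- The Gaussian area of the sphere of radius `r` centered at `x₀`. -/
noncomputable def gaussianSphereArea (n : ℕ) (x₀ : EuclideanSpace ℝ (Fin n)) (r : ℝ) : ℝ :=
  ∫ θ : Metric.sphere (0 : EuclideanSpace ℝ (Fin n)) 1,
    r ^ (n - 1) * gaussianDensity n (x₀ + r • (θ : EuclideanSpace ℝ (Fin n))) ∂volume.toSphere

theorem integrable_toSphere_of_continuous {f : Metric.sphere (0 : EuclideanSpace ℝ (Fin n)) 1 → ℝ}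
    (hf : Continuous f) : Integrable f (volume : Measure (EuclideanSpace ℝ (Fin n))).toSphere :=
  hf.integrable_of_hasCompactSupport (HasCompactSupport.of_compactSpace f)

/-- A vector field of norm at most one which is the outer unit normal on the sphere of radius `r`
centered at `x₀`. -/
noncomputable def sphereNormalField (x₀ : EuclideanSpace ℝ (Fin n)) (r : ℝ)
    (x : EuclideanSpace ℝ (Fin n)) : EuclideanSpace ℝ (Fin n) :=
  (2 * r / (r ^ 2 + ‖x - x₀‖ ^ 2)) • (x - x₀)

theorem admissible_sphereNormalField (x₀ : EuclideanSpace ℝ (Fin n)) {r : ℝ} (hr : 0 < r) :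
    Admissible n (sphereNormalField x₀ r) := by
  have hpos : ∀ x : EuclideanSpace ℝ (Fin n), 0 < r ^ 2 + ‖x - x₀‖ ^ 2 := fun x => by positivity
  refine ⟨?_, ⟨2 / r + 4 / r, fun x => ?_⟩, fun x => ?_⟩
  · unfold sphereNormalField
    have h : ContDiff ℝ 1 fun x : EuclideanSpace ℝ (Fin n) => r ^ 2 + ‖x - x₀‖ ^ 2 :=
      contDiff_const.add ((contDiff_id.sub contDiff_const).norm_sq ℝ)
    exact (contDiff_const.div h fun x => (hpos x).ne').smul (contDiff_id.sub contDiff_const)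
  · have hsub : HasFDerivAt (fun x : EuclideanSpace ℝ (Fin n) => x - x₀)
        (ContinuousLinearMap.id ℝ _) x := (hasFDerivAt_id x).sub_const x₀
    have h1 := (hsub.norm_sq.const_add (r ^ 2))
    have h2 := (((hasDerivAt_inv (hpos x).ne').comp_hasFDerivAt x h1).const_mul (2 * r)).smul hsub
    have h3 : HasFDerivAt (sphereNormalField x₀ r) _ x := h2
    rw [h3.fderiv]
    refine ContinuousLinearMap.opNorm_le_bound _ (by positivity) fun v => ?_
    set y := x - x₀
    set t := ‖y‖ with ht
    have hD := hpos x
    have hD' : 0 < r ^ 2 + t ^ 2 := hD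
    have hyv : ‖⟪y, v⟫‖ ≤ t * ‖v‖ := norm_inner_le_norm y v
    simp only [add_apply, smul_apply, ContinuousLinearMap.smulRight_apply,
      ContinuousLinearMap.comp_apply, ContinuousLinearMap.id_apply,
      innerSL_apply_apply, smul_eq_mul, nsmul_eq_mul, Function.comp]
    rw [add_mul]
    refine (norm_add_le _ _).trans (add_le_add ?_ ?_)
    · change ‖(2 * r * (r ^ 2 + t ^ 2)⁻¹) • v‖ ≤ _
      rw [norm_smul, Real.norm_of_nonneg (by positivity)]
      refine mul_le_mul_of_nonneg_right ?_ (norm_nonneg v)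
      rw [← div_eq_mul_inv, div_le_div_iff₀ hD' hr]
      nlinarith [sq_nonneg t]
    · rw [norm_smul, ← ht]
      calc _ = 4 * r * ((r ^ 2 + t ^ 2) ^ 2)⁻¹ * ‖⟪y, v⟫‖ * t := by
            simp only [norm_mul, norm_neg, norm_inv, norm_pow, Real.norm_of_nonneg hr.le,
              Real.norm_of_nonneg hD'.le, Nat.cast_ofNat, Real.norm_ofNat]
            ring
        _ ≤ 4 * r * ((r ^ 2 + t ^ 2) ^ 2)⁻¹ * (t * ‖v‖) * t := by gcongr
        _ = 4 * r * t ^ 2 / (r ^ 2 + t ^ 2) ^ 2 * ‖v‖ := by ring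
        _ ≤ 4 / r * ‖v‖ := by
            refine mul_le_mul_of_nonneg_right ?_ (norm_nonneg v)
            rw [div_le_div_iff₀ (by positivity) hr]
            nlinarith [sq_nonneg (r ^ 2), sq_nonneg (t ^ 2), mul_nonneg (sq_nonneg r) (sq_nonneg t)]
  · unfold sphereNormalField
    have := hpos x
    rw [norm_smul, Real.norm_of_nonneg (by positivity), div_mul_eq_mul_div, div_le_one this]
    nlinarith [sq_nonneg (r - ‖x - x₀‖)]

theorem gPerimeter_ball [Nontrivial (EuclideanSpace ℝ (Fin n))]
    (x₀ : EuclideanSpace ℝ (Fin n)) {r : ℝ} (hr : 0 < r) :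
    gPerimeter n (Metric.ball x₀ r) = ENNReal.ofReal (gaussianSphereArea n x₀ r) := by
  unfold gPerimeter totVar gaussianSphereArea
  have hρ := continuous_gaussianDensity (n := n)
  rw [integral_const_mul]
  have hθ : ∀ θ : Metric.sphere (0 : EuclideanSpace ℝ (Fin n)) 1,
      ‖(θ : EuclideanSpace ℝ (Fin n))‖ = 1 := fun θ => by simp
  apply le_antisymm
  · refine iSup₂_le fun φ hφ => ENNReal.ofReal_le_ofReal ?_
    have hφc := hφ.1.continuous
    rw [integral_ball_gdiv hφ.1 x₀ hr]
    refine mul_le_mul_of_nonneg_left (integral_mono ?_ ?_ fun θ => ?_) (by positivity)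
    · exact integrable_toSphere_of_continuous (by fun_prop)
    · exact integrable_toSphere_of_continuous (by fun_prop)
    · refine mul_le_of_le_one_right (gaussianDensity_nonneg _) ?_
      refine (real_inner_le_norm _ _).trans ?_
      rw [hθ, mul_one]
      exact hφ.2.2 _
  · have hadm := admissible_sphereNormalField x₀ hr
    refine le_iSup₂_of_le (sphereNormalField x₀ r) hadm (ENNReal.ofReal_le_ofReal (le_of_eq ?_))
    rw [integral_ball_gdiv hadm.1 x₀ hr]
    congr 2
    ext θ
    have : ⟪sphereNormalField x₀ r (x₀ + r • (θ : EuclideanSpace ℝ (Fin n))),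
        (θ : EuclideanSpace ℝ (Fin n))⟫ = 1 := by
      simp only [sphereNormalField, add_sub_cancel_left, inner_smul_left, norm_smul, hθ,
        real_inner_self_eq_norm_sq, conj_trivial, Real.norm_eq_abs]
      simp only [mul_one, sq_abs, one_pow]
      field_simp
      norm_num
    rw [this, mul_one]

theorem gPerimeter_ball_zero (x₀ : EuclideanSpace ℝ (Fin n)) :
    gPerimeter n (Metric.ball x₀ 0) = 0 := by
  simp [gPerimeter, totVar]

theorem gaussianSphereArea_zero (hn : 2 ≤ n) (x₀ : EuclideanSpace ℝ (Fin n)) :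
    gaussianSphereArea n x₀ 0 = 0 := by
  simp [gaussianSphereArea, zero_pow (show n - 1 ≠ 0 by omega)]

theorem gaussianSphereArea_nonneg (x₀ : EuclideanSpace ℝ (Fin n)) {r : ℝ} (hr : 0 ≤ r) :
    0 ≤ gaussianSphereArea n x₀ r :=
  integral_nonneg fun θ => mul_nonneg (by positivity) (gaussianDensity_nonneg _)

theorem continuous_gaussianSphereArea (x₀ : EuclideanSpace ℝ (Fin n)) :
    Continuous (gaussianSphereArea n x₀) := by
  have hρ := continuous_gaussianDensity (n := n)
  exact continuous_integral_toSphere _ (by unfold Function.uncurry; fun_prop)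

theorem tendsto_gaussianSphereArea_atTop (x₀ : EuclideanSpace ℝ (Fin n)) :
    Tendsto (gaussianSphereArea n x₀) atTop (nhds 0) := by
  have hρ := continuous_gaussianDensity (n := n)
  set C : ℝ := (2 * π) ^ (-(n : ℝ) / 2) * Real.exp (‖x₀‖ ^ 2 / 2 + 1) *
    (volume : Measure (EuclideanSpace ℝ (Fin n))).toSphere.real Set.univ with hC
  have h0 : Tendsto (fun r : ℝ => C * (r ^ (n - 1) * Real.exp (-r))) atTop (nhds 0) := by
    simpa using (tendsto_pow_mul_exp_neg_atTop_nhds_zero (n - 1)).const_mul C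
  refine tendsto_of_tendsto_of_tendsto_of_le_of_le' tendsto_const_nhds h0 ?_ ?_
  · filter_upwards [eventually_ge_atTop 0] with r hr using gaussianSphereArea_nonneg x₀ hr
  · filter_upwards [eventually_ge_atTop 0] with r hr
    have hb : ∀ θ : Metric.sphere (0 : EuclideanSpace ℝ (Fin n)) 1,
        r ^ (n - 1) * gaussianDensity n (x₀ + r • (θ : EuclideanSpace ℝ (Fin n))) ≤
        (2 * π) ^ (-(n : ℝ) / 2) * Real.exp (‖x₀‖ ^ 2 / 2 + 1) * (r ^ (n - 1) * Real.exp (-r)) := by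
      intro θ
      have hθ : ‖(θ : EuclideanSpace ℝ (Fin n))‖ = 1 := by simp
      have hle : r ≤ ‖x₀ + r • (θ : EuclideanSpace ℝ (Fin n))‖ + ‖x₀‖ := by
        have := norm_sub_le (x₀ + r • (θ : EuclideanSpace ℝ (Fin n))) x₀
        rwa [add_sub_cancel_left, norm_smul, hθ, mul_one, Real.norm_of_nonneg hr] at this
      set a := ‖x₀ + r • (θ : EuclideanSpace ℝ (Fin n))‖ with ha
      unfold gaussianDensity
      rw [← ha]
      have : Real.exp (-a ^ 2 / 2) ≤ Real.exp (‖x₀‖ ^ 2 / 2 + 1) * Real.exp (-r) := by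
        rw [← Real.exp_add]
        refine Real.exp_le_exp.2 ?_
        nlinarith [sq_nonneg (a - 1), sq_nonneg (‖x₀‖ - 1)]
      have h2 : 0 ≤ r ^ (n - 1) * (2 * π) ^ (-(n : ℝ) / 2) := by positivity
      nlinarith [mul_le_mul_of_nonneg_left this h2]
    calc gaussianSphereArea n x₀ r ≤ ∫ θ : Metric.sphere (0 : EuclideanSpace ℝ (Fin n)) 1,
          (2 * π) ^ (-(n : ℝ) / 2) * Real.exp (‖x₀‖ ^ 2 / 2 + 1) * (r ^ (n - 1) * Real.exp (-r))
            ∂volume.toSphere :=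
          integral_mono (integrable_toSphere_of_continuous (by fun_prop))
            (integrable_const _) hb
      _ = C * (r ^ (n - 1) * Real.exp (-r)) := by
          rw [integral_const, smul_eq_mul, hC]; ring

theorem hasDerivAt_pow_mul_gaussianDensity (hn : 2 ≤ n) (x₀ v : EuclideanSpace ℝ (Fin n))
    (hv : ‖v‖ = 1) (r : ℝ) :
    HasDerivAt (fun r : ℝ => r ^ (n - 1) * gaussianDensity n (x₀ + r • v))
      (r ^ (n - 2) * gaussianDensity n (x₀ + r • v) *
        ((n - 1 : ℕ) - r * (⟪x₀, v⟫ + r))) r := by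
  have h1 : HasDerivAt (fun r : ℝ => x₀ + r • v) v r := by
    simpa using ((hasDerivAt_id r).smul_const v).const_add x₀
  have h2 := (contDiff_gaussianDensity.differentiable one_ne_zero
    (x₀ + r • v)).hasFDerivAt.comp_hasDerivAt r h1
  rw [fderiv_gaussianDensity, inner_add_left, inner_smul_left, real_inner_self_eq_norm_sq, hv] at h2
  refine ((hasDerivAt_pow (n - 1) r).mul h2).congr_deriv ?_
  obtain ⟨m, rfl⟩ := Nat.exists_eq_add_of_le hn
  rw [show 2 + m - 1 - 1 = m by omega, show 2 + m - 1 = m + 1 by omega,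
    show 2 + m - 2 = m by omega]
  simp only [Function.comp_apply, conj_trivial]
  ring

theorem monotoneOn_gaussianSphereArea (hn : 2 ≤ n) (x₀ : EuclideanSpace ℝ (Fin n)) :
    MonotoneOn (gaussianSphereArea n x₀) (Set.Icc 0 (1 / (‖x₀‖ + 1))) := by
  have hρ := continuous_gaussianDensity (n := n)
  intro a ha b hb hab
  refine integral_mono (integrable_toSphere_of_continuous (by fun_prop))
    (integrable_toSphere_of_continuous (by fun_prop)) fun θ => ?_
  have hθ : ‖(θ : EuclideanSpace ℝ (Fin n))‖ = 1 := by simp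
  have hd := hasDerivAt_pow_mul_gaussianDensity hn x₀ θ hθ
  refine monotoneOn_of_deriv_nonneg (convex_Icc 0 (1 / (‖x₀‖ + 1))) (fun r _ =>
    (hd r).continuousAt.continuousWithinAt) (fun r _ =>
    (hd r).differentiableAt.differentiableWithinAt) (fun r hr => ?_) ha hb hab
  rw [interior_Icc] at hr
  rw [(hd r).deriv]
  have hr0 : 0 < r := hr.1
  have hr1 : r * (‖x₀‖ + 1) < 1 := (lt_div_iff₀ (by positivity)).1 hr.2
  have hin : ⟪x₀, (θ : EuclideanSpace ℝ (Fin n))⟫ ≤ ‖x₀‖ := by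
    simpa [hθ] using real_inner_le_norm x₀ (θ : EuclideanSpace ℝ (Fin n))
  have hn1 : (1 : ℝ) ≤ (n - 1 : ℕ) := by exact_mod_cast (show 1 ≤ n - 1 by omega)
  have hr2 : r ≤ 1 := by nlinarith [norm_nonneg x₀]
  refine mul_nonneg (mul_nonneg (by positivity) (gaussianDensity_nonneg _)) ?_
  have : r * (⟪x₀, (θ : EuclideanSpace ℝ (Fin n))⟫ + r) ≤ r * (‖x₀‖ + 1) := by gcongr
  linarith

theorem antitoneOn_gaussianSphereArea (hn : 2 ≤ n) (x₀ : EuclideanSpace ℝ (Fin n)) :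
    AntitoneOn (gaussianSphereArea n x₀) (Set.Ici (‖x₀‖ + n)) := by
  have hρ := continuous_gaussianDensity (n := n)
  intro a ha b hb hab
  refine integral_mono (integrable_toSphere_of_continuous (by fun_prop))
    (integrable_toSphere_of_continuous (by fun_prop)) fun θ => ?_
  have hθ : ‖(θ : EuclideanSpace ℝ (Fin n))‖ = 1 := by simp
  have hd := hasDerivAt_pow_mul_gaussianDensity hn x₀ θ hθ
  refine antitoneOn_of_deriv_nonpos (convex_Ici (‖x₀‖ + n)) (fun r _ =>
    (hd r).continuousAt.continuousWithinAt) (fun r _ =>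
    (hd r).differentiableAt.differentiableWithinAt) (fun r hr => ?_) ha hb hab
  rw [interior_Ici] at hr
  rw [(hd r).deriv]
  have hr' : ‖x₀‖ + n < r := hr
  have hn2 : (2 : ℝ) ≤ n := by exact_mod_cast hn
  have hr1 : 1 ≤ r := by linarith [norm_nonneg x₀]
  have hin : -‖x₀‖ ≤ ⟪x₀, (θ : EuclideanSpace ℝ (Fin n))⟫ := by
    have := abs_real_inner_le_norm x₀ (θ : EuclideanSpace ℝ (Fin n))
    rw [hθ, mul_one] at this
    exact (abs_le.1 this).1
  have hn1 : ((n - 1 : ℕ) : ℝ) ≤ n := by exact_mod_cast Nat.sub_le n 1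
  refine mul_nonpos_of_nonneg_of_nonpos
    (mul_nonneg (by positivity) (gaussianDensity_nonneg _)) ?_
  nlinarith

end Gaussian

/-- For `n ≥ 2` and `x₀ ∈ ℝ^n`, let `p(r) := P_γ(B_r(x₀))`. Then
`p(r) < ∞` for every `r ≥ 0`, `p` is continuous on `[0,∞)`, `p(r) → 0` as `r → 0⁺` and
as `r → ∞`, and there exist `0 < r_m < r_M` such that `p` is monotone increasing on
`[0, r_m]` and monotone decreasing on `[r_M, ∞)`. -/
theorem perimeter_of_balls_behavior (n : ℕ) (hn : 2 ≤ n) (x₀ : EuclideanSpace ℝ (Fin n)) :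
    (∀ r : ℝ, 0 ≤ r → gPerimeter n (Metric.ball x₀ r) < ⊤) ∧
    ContinuousOn (fun r : ℝ => (gPerimeter n (Metric.ball x₀ r)).toReal) (Set.Ici 0) ∧
    Tendsto (fun r : ℝ => (gPerimeter n (Metric.ball x₀ r)).toReal)
      (nhdsWithin 0 (Set.Ioi 0)) (nhds 0) ∧
    Tendsto (fun r : ℝ => (gPerimeter n (Metric.ball x₀ r)).toReal) atTop (nhds 0) ∧
    ∃ rm rM : ℝ, 0 < rm ∧ rm < rM ∧
      MonotoneOn (fun r : ℝ => (gPerimeter n (Metric.ball x₀ r)).toReal) (Set.Icc 0 rm) ∧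
      AntitoneOn (fun r : ℝ => (gPerimeter n (Metric.ball x₀ r)).toReal) (Set.Ici rM) := by
  have : Nonempty (Fin n) := ⟨⟨0, by omega⟩⟩
  have : Nontrivial (EuclideanSpace ℝ (Fin n)) := inferInstance
  have hper : ∀ r, 0 ≤ r →
      gPerimeter n (Metric.ball x₀ r) = ENNReal.ofReal (gaussianSphereArea n x₀ r) := by
    intro r hr
    rcases hr.eq_or_lt with rfl | hr
    · rw [gPerimeter_ball_zero, gaussianSphereArea_zero hn, ENNReal.ofReal_zero]
    · exact gPerimeter_ball x₀ hr
  have heq : Set.EqOn (fun r : ℝ => (gPerimeter n (Metric.ball x₀ r)).toReal)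
      (gaussianSphereArea n x₀) (Set.Ici 0) := fun r hr => by
    simp only [hper r hr, ENNReal.toReal_ofReal (gaussianSphereArea_nonneg x₀ hr)]
  have hc := continuous_gaussianSphereArea x₀
  have hn2 : (2 : ℝ) ≤ n := by exact_mod_cast hn
  have hx := norm_nonneg x₀
  have hle : 1 / (‖x₀‖ + 1) ≤ 1 := by rw [div_le_one (by positivity)]; linarith
  refine ⟨fun r hr => by rw [hper r hr]; exact ENNReal.ofReal_lt_top,
    hc.continuousOn.congr heq, ?_, ?_, 1 / (‖x₀‖ + 1), ‖x₀‖ + n, by positivity, by linarith, ?_, ?_⟩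
  · have h0 := (hc.tendsto 0).mono_left (nhdsWithin_le_nhds (s := Set.Ioi 0))
    rw [gaussianSphereArea_zero hn] at h0
    refine h0.congr' ?_
    filter_upwards [self_mem_nhdsWithin] with r hr
    exact (heq (Set.mem_Ici.2 (le_of_lt (Set.mem_Ioi.1 hr)))).symm
  · refine (tendsto_gaussianSphereArea_atTop x₀).congr' ?_
    filter_upwards [eventually_ge_atTop 0] with r hr using (heq hr).symm
  · exact (monotoneOn_gaussianSphereArea hn x₀).congr
      (heq.symm.mono Set.Icc_subset_Ici_self)
  · exact (antitoneOn_gaussianSphereArea hn x₀).congr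
      (heq.symm.mono (Set.Ici_subset_Ici.2 (by positivity)))
end

section
/- Let u ∈ L¹(γ_n) have finite Gaussian total variation V_γ(u) < ∞. Then for almost every r ∈ ℝ the sublevel set {u < r} has finite Gaussian perimeter, and the coarea formula holds: V_γ(u) = ∫_ℝ P_γ({u < r}) dr. -/
open MeasureTheory Real Filter
open scoped RealInnerProductSpace ENNReal

open ProbabilityTheory

theorem gaussianMeasure_eq_stdGaussian (n : ℕ) :
    gaussianMeasure n = stdGaussian (EuclideanSpace ℝ (Fin n)) := by
  have hint : Integrable (fun x : EuclideanSpace ℝ (Fin n) ↦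
      (2 * π) ^ (-(n : ℝ) / 2) * Real.exp (-‖x‖ ^ 2 / 2)) := by
    refine Integrable.const_mul ?_ _
    have := GaussianFourier.integrable_cexp_neg_mul_sq_norm_add (V := EuclideanSpace ℝ (Fin n))
      (b := (1 / 2 : ℂ)) (by norm_num) 0 0
    convert this.re using 2 with x
    have h : -(1 / 2 : ℂ) * (‖x‖ : ℂ) ^ 2 + 0 * ((inner ℝ 0 x : ℝ) : ℂ)
        = ((-‖x‖ ^ 2 / 2 : ℝ) : ℂ) := by
      push_cast; ring
    rw [h, ← Complex.ofReal_exp]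
    rfl
  have hfin : IsFiniteMeasure (gaussianMeasure n) :=
    isFiniteMeasure_withDensity_ofReal hint.2
  apply Measure.ext_of_charFun
  ext t
  rw [charFun_stdGaussian, charFun_apply, gaussianMeasure,
    integral_withDensity_eq_integral_toReal_smul (by fun_prop) (by simp)]
  have hF := GaussianFourier.integral_cexp_neg_mul_sq_norm_add (V := EuclideanSpace ℝ (Fin n))
      (b := (1 / 2 : ℂ)) (by norm_num) Complex.I t
  have : ∀ x : EuclideanSpace ℝ (Fin n),
      (ENNReal.ofReal ((2 * π) ^ (-(n : ℝ) / 2) * Real.exp (-‖x‖ ^ 2 / 2))).toReal •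
        Complex.exp ((inner ℝ x t : ℝ) * Complex.I) =
      (((2 * π) ^ (-(n : ℝ) / 2) : ℝ) : ℂ) *
        Complex.exp (-(1 / 2 : ℂ) * (‖x‖ : ℂ) ^ 2 + Complex.I * (inner ℝ t x : ℝ)) := by
    intro x
    rw [ENNReal.toReal_ofReal (by positivity), Complex.real_smul, Complex.ofReal_mul, mul_assoc,
      Complex.ofReal_exp, ← Complex.exp_add, real_inner_comm]
    congr 2
    push_cast
    ring
  simp_rw [this]
  rw [integral_const_mul, hF, ← mul_assoc]
  have h2 : (((2 * π) ^ (-(n : ℝ) / 2) : ℝ) : ℂ) *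
      ((π : ℂ) / (1 / 2)) ^ ((Module.finrank ℝ (EuclideanSpace ℝ (Fin n)) : ℂ) / 2) = 1 := by
    have h3 : ((π : ℂ) / (1 / 2)) ^ ((Module.finrank ℝ (EuclideanSpace ℝ (Fin n)) : ℂ) / 2)
        = (((2 * π) ^ ((n : ℝ) / 2) : ℝ) : ℂ) := by
      rw [Complex.ofReal_cpow (by positivity)]
      simp
      ring_nf
    rw [h3, ← Complex.ofReal_mul, ← Real.rpow_add (by positivity)]
    simp [neg_div]
  rw [h2, one_mul]
  congr 1
  rw [Complex.I_sq]
  ring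

instance isProbabilityMeasure_gaussianMeasure (n : ℕ) :
    IsProbabilityMeasure (gaussianMeasure n) := by
  rw [gaussianMeasure_eq_stdGaussian]; infer_instance

instance isGaussian_gaussianMeasure (n : ℕ) : IsGaussian (gaussianMeasure n) := by
  rw [gaussianMeasure_eq_stdGaussian]; infer_instance

theorem map_rotation_gaussianMeasure_prod (n : ℕ) (θ : ℝ) :
    ((gaussianMeasure n).prod (gaussianMeasure n)).map (ContinuousLinearMap.rotation θ) =
      (gaussianMeasure n).prod (gaussianMeasure n) := by
  refine IsGaussian.map_rotation_eq_self_of_forall_strongDual_eq_zero (fun L ↦ ?_) θ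
  rw [gaussianMeasure_eq_stdGaussian]
  exact integral_strongDual_stdGaussian L

theorem integrable_norm_pow_gaussianMeasure (n k : ℕ) :
    Integrable (fun x ↦ ‖x‖ ^ k) (gaussianMeasure n) := by
  by_cases hk : k = 0
  · simp [hk]
  simpa using (IsGaussian.memLp_id (gaussianMeasure n) k (by simp)).integrable_norm_pow hk

theorem map_inner_gaussianMeasure (n : ℕ) (a : EuclideanSpace ℝ (Fin n)) :
    (gaussianMeasure n).map (fun y ↦ ⟪a, y⟫) = gaussianReal 0 (‖a‖₊ ^ 2) := by
  have h := IsGaussian.map_eq_gaussianReal (μ := gaussianMeasure n) (innerSL ℝ a)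
  rw [gaussianMeasure_eq_stdGaussian, integral_strongDual_stdGaussian,
    variance_dual_stdGaussian] at h
  rw [gaussianMeasure_eq_stdGaussian]
  rw [innerSL_apply_norm, ← coe_nnnorm, ← NNReal.coe_pow, Real.toNNReal_coe] at h
  exact h

/-- Gaussian integration by parts. -/
theorem integral_fderiv_gaussianMeasure {n : ℕ} {F : EuclideanSpace ℝ (Fin n) → ℝ}
    (v : EuclideanSpace ℝ (Fin n)) (hF : Differentiable ℝ F)
    (h1 : Integrable (fun x ↦ fderiv ℝ F x v) (gaussianMeasure n))
    (h2 : Integrable (fun x ↦ F x * ⟪v, x⟫) (gaussianMeasure n))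
    (h3 : Integrable F (gaussianMeasure n)) :
    ∫ x, fderiv ℝ F x v ∂gaussianMeasure n = ∫ x, F x * ⟪v, x⟫ ∂gaussianMeasure n := by
  set w : EuclideanSpace ℝ (Fin n) → ℝ := fun x ↦
    (2 * π) ^ (-(n : ℝ) / 2) * Real.exp (-‖x‖ ^ 2 / 2) with hw
  have hw0 : ∀ x, 0 ≤ w x := fun x ↦ by positivity
  have hwm : Measurable fun x ↦ ENNReal.ofReal (w x) := by fun_prop
  have hint (G : EuclideanSpace ℝ (Fin n) → ℝ) :
      ∫ x, G x ∂gaussianMeasure n = ∫ x, G x * w x := by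
    rw [gaussianMeasure, integral_withDensity_eq_integral_toReal_smul hwm (by simp)]
    simp_rw [ENNReal.toReal_ofReal (hw0 _), smul_eq_mul, mul_comm]
  have hinteg (G : EuclideanSpace ℝ (Fin n) → ℝ) (hG : Integrable G (gaussianMeasure n)) :
      Integrable fun x ↦ G x * w x := by
    rw [gaussianMeasure, integrable_withDensity_iff_integrable_smul' hwm (by simp)] at hG
    simp_rw [ENNReal.toReal_ofReal (hw0 _), smul_eq_mul, mul_comm] at hG
    simpa only [mul_comm] using hG
  have hwd : ∀ x, HasFDerivAt w (-(w x) • innerSL ℝ x) x := by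
    intro x
    have := (((hasStrictFDerivAt_norm_sq x).hasFDerivAt.fun_neg.mul_const (1 / 2 : ℝ)).exp).const_mul
      ((2 * π) ^ (-(n : ℝ) / 2))
    have hfun : w = fun y ↦ (2 * π) ^ (-(n : ℝ) / 2) * Real.exp (-‖y‖ ^ 2 * (1 / 2)) := by
      ext y; simp only [hw]; ring_nf
    have hder : -(w x) • innerSL ℝ x = (2 * π) ^ (-(n : ℝ) / 2) •
        Real.exp (-‖x‖ ^ 2 * (1 / 2)) • (1 / 2 : ℝ) • -(2 • innerSL ℝ x) := by
      rw [hfun]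
      ext y
      simp
      ring
    rw [hder, hfun]
    exact this
  have hwv : ∀ x, fderiv ℝ w x v = - (⟪v, x⟫ * w x) := by
    intro x
    rw [(hwd x).fderiv]
    simp [real_inner_comm, mul_comm]
  have key := integral_mul_fderiv_eq_neg_fderiv_mul_of_integrable (μ := volume) (f := F) (g := w)
    (v := v) (hinteg _ h1) ?_ (hinteg _ h3) (fun x _ ↦ hF x)
    (fun x _ ↦ (hwd x).differentiableAt)
  · rw [hint, hint, ← neg_eq_iff_eq_neg.mpr key, ← integral_neg]
    congr 1 with x
    rw [hwv]; ring
  · simp_rw [hwv]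
    convert (hinteg _ h2).neg using 2 with x
    simp; ring

/-- The absolute first moment of a one-dimensional marginal of the Gaussian measure. -/
theorem integral_abs_inner_gaussianMeasure {n : ℕ} (v : EuclideanSpace ℝ (Fin n)) :
    ∫ y, |⟪v, y⟫| ∂gaussianMeasure n = √(2 / π) * ‖v‖ := by
  have hunit (e : EuclideanSpace ℝ (Fin n)) (he : ‖e‖ = 1) :
      ∫ y, |⟪e, y⟫| ∂gaussianMeasure n = √(2 / π) := by
    have h1 : ∫ y, |⟪e, y⟫| ∂gaussianMeasure n = ∫ t, |t| ∂gaussianReal 0 1 := by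
      have := map_inner_gaussianMeasure n e
      rw [show ‖e‖₊ = 1 from NNReal.eq he, one_pow] at this
      rw [← this, integral_map (by fun_prop) (by fun_prop)]
    have h2 : ∫ t in Set.Ioi (0 : ℝ), t * Real.exp (-(1 / 2) * t ^ 2) = 1 := by
      have := integral_rpow_mul_exp_neg_mul_rpow (p := 2) (q := 1) (b := 1 / 2) (by norm_num)
        (by norm_num) (by norm_num)
      norm_num at this
      norm_num
      exact this
    rw [h1, integral_gaussianReal_eq_integral_smul (by norm_num)]
    have h3 : ∀ t : ℝ, gaussianPDFReal 0 1 t • |t| =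
        (√(2 * π))⁻¹ * (fun s : ℝ ↦ s * Real.exp (-(1 / 2) * s ^ 2)) |t| := by
      intro t
      simp [gaussianPDFReal]
      ring_nf
    simp_rw [h3]
    rw [integral_const_mul, integral_comp_abs (f := fun s : ℝ ↦ s * Real.exp (-(1 / 2) * s ^ 2)),
      h2, mul_one]
    rw [Real.sqrt_div (by norm_num), Real.sqrt_mul (by norm_num)]
    have := Real.sq_sqrt (show (0 : ℝ) ≤ 2 by norm_num)
    field_simp
    linarith
  rcases eq_or_ne v 0 with rfl | hv
  · simp
  have hv' : ‖v‖ ≠ 0 := norm_ne_zero_iff.mpr hv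
  have := hunit (‖v‖⁻¹ • v) (by simp [norm_smul, hv'])
  simp_rw [real_inner_smul_left, abs_mul, abs_inv, abs_norm, integral_const_mul] at this
  rw [← this]
  field_simp

/-- The vector field `x ↦ 𝔼[f(x, Y) Y]`, with `Y` a standard Gaussian vector. -/
noncomputable def gaussianField (n : ℕ)
    (f : EuclideanSpace ℝ (Fin n) × EuclideanSpace ℝ (Fin n) → ℝ)
    (x : EuclideanSpace ℝ (Fin n)) : EuclideanSpace ℝ (Fin n) :=
  ∫ y, f (x, y) • y ∂gaussianMeasure n

section gaussianField

variable {n : ℕ} {f : EuclideanSpace ℝ (Fin n) × EuclideanSpace ℝ (Fin n) → ℝ} {C : ℝ}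

theorem integrable_smul_id_gaussianMeasure (hf : Continuous f) (hb : ∀ p, |f p| ≤ 1)
    (x : EuclideanSpace ℝ (Fin n)) :
    Integrable (fun y ↦ f (x, y) • y) (gaussianMeasure n) := by
  refine (integrable_norm_pow_gaussianMeasure n 1).mono' ?_ (.of_forall fun y ↦ ?_)
  · exact Continuous.aestronglyMeasurable (by fun_prop)
  · rw [norm_smul, pow_one]
    exact mul_le_of_le_one_left (norm_nonneg _) (hb _)

theorem norm_gaussianField_le (hf : Continuous f) (hb : ∀ p, |f p| ≤ 1)
    (x : EuclideanSpace ℝ (Fin n)) : ‖gaussianField n f x‖ ≤ √(2 / π) := by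
  set v := gaussianField n f x with hv
  have h : ‖v‖ * ‖v‖ ≤ √(2 / π) * ‖v‖ := by
    rw [← real_inner_self_eq_norm_mul_norm, ← integral_abs_inner_gaussianMeasure]
    conv_lhs => rw [hv, gaussianField]
    rw [real_inner_comm, ← integral_inner (integrable_smul_id_gaussianMeasure hf hb x)]
    refine integral_mono ((integrable_smul_id_gaussianMeasure hf hb x).const_inner _) ?_ fun y ↦ ?_
    · have := (integrable_smul_id_gaussianMeasure (f := fun _ : EuclideanSpace ℝ (Fin n) ×
        EuclideanSpace ℝ (Fin n) ↦ (1 : ℝ)) (by fun_prop) (by simp) x)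
      simp only [one_smul] at this
      exact (this.const_inner v).abs
    · simp only [real_inner_smul_right]
      refine (le_abs_self _).trans ?_
      rw [abs_mul]
      exact mul_le_of_le_one_left (abs_nonneg _) (hb _)
  rcases (norm_nonneg v).eq_or_lt with h0 | h0
  · rw [← h0]; positivity
  · exact le_of_mul_le_mul_right h h0

/-- The integrand of the derivative of `gaussianField`. -/
noncomputable def gaussianFieldDeriv
    (f : EuclideanSpace ℝ (Fin n) × EuclideanSpace ℝ (Fin n) → ℝ)
    (x y : EuclideanSpace ℝ (Fin n)) :
    EuclideanSpace ℝ (Fin n) →L[ℝ] EuclideanSpace ℝ (Fin n) :=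
  ((fderiv ℝ f (x, y)).comp (.inl ℝ _ _)).smulRight y

theorem continuous_gaussianFieldDeriv (hf : ContDiff ℝ 1 f) :
    Continuous (Function.uncurry (gaussianFieldDeriv f)) := by
  have h1 : Continuous (fderiv ℝ f) := hf.continuous_fderiv (by simp)
  have h2 : Continuous fun p : EuclideanSpace ℝ (Fin n) × EuclideanSpace ℝ (Fin n) ↦
      (ContinuousLinearMap.smulRightL ℝ (EuclideanSpace ℝ (Fin n)) (EuclideanSpace ℝ (Fin n)))
      ((fderiv ℝ f p).comp (.inl ℝ _ _)) p.2 := by fun_prop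
  exact h2

theorem norm_gaussianFieldDeriv_le (hd : ∀ p, ‖fderiv ℝ f p‖ ≤ C * (1 + ‖p.2‖))
    (x y : EuclideanSpace ℝ (Fin n)) :
    ‖gaussianFieldDeriv f x y‖ ≤ C * (1 + ‖y‖) * ‖y‖ := by
  rw [gaussianFieldDeriv, ContinuousLinearMap.norm_smulRight_apply]
  gcongr
  calc _ ≤ ‖fderiv ℝ f (x, y)‖ * ‖ContinuousLinearMap.inl ℝ _ _‖ :=
        ContinuousLinearMap.opNorm_comp_le _ _
    _ ≤ ‖fderiv ℝ f (x, y)‖ * 1 := by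
        gcongr
        exact ContinuousLinearMap.norm_inl_le_one ..
    _ ≤ _ := by rw [mul_one]; exact hd (x, y)

theorem integrable_bound_gaussianFieldDeriv (n : ℕ) (C : ℝ) :
    Integrable (fun y ↦ C * (1 + ‖y‖) * ‖y‖) (gaussianMeasure n) := by
  have h := ((integrable_norm_pow_gaussianMeasure n 1).add
    (integrable_norm_pow_gaussianMeasure n 2)).const_mul C
  refine h.congr (.of_forall fun y ↦ ?_)
  simp only [Pi.add_apply]
  ring

theorem integrable_gaussianFieldDeriv (hf : ContDiff ℝ 1 f)
    (hd : ∀ p, ‖fderiv ℝ f p‖ ≤ C * (1 + ‖p.2‖)) (x : EuclideanSpace ℝ (Fin n)) :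
    Integrable (gaussianFieldDeriv f x) (gaussianMeasure n) :=
  (integrable_bound_gaussianFieldDeriv n C).mono'
    ((continuous_gaussianFieldDeriv hf).comp (by fun_prop :
      Continuous fun y ↦ (x, y))).aestronglyMeasurable
    (.of_forall (norm_gaussianFieldDeriv_le hd x))

theorem hasFDerivAt_gaussianField (hf : ContDiff ℝ 1 f) (hb : ∀ p, |f p| ≤ 1)
    (hd : ∀ p, ‖fderiv ℝ f p‖ ≤ C * (1 + ‖p.2‖)) (x : EuclideanSpace ℝ (Fin n)) :
    HasFDerivAt (gaussianField n f) (∫ y, gaussianFieldDeriv f x y ∂gaussianMeasure n) x := by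
  refine hasFDerivAt_integral_of_dominated_of_fderiv_le (s := Set.univ) univ_mem
    (.of_forall fun z ↦ (integrable_smul_id_gaussianMeasure hf.continuous hb z).1)
    (integrable_smul_id_gaussianMeasure hf.continuous hb x)
    (integrable_gaussianFieldDeriv hf hd x).1
    (.of_forall fun y z _ ↦ norm_gaussianFieldDeriv_le hd z y)
    (integrable_bound_gaussianFieldDeriv n C) (.of_forall fun y z _ ↦ ?_)
  have h1 : HasFDerivAt (fun z ↦ f (z, y)) ((fderiv ℝ f (z, y)).comp (.inl ℝ _ _)) z :=
    ((hf.differentiable (by simp)) (z, y)).hasFDerivAt.comp z (hasFDerivAt_prodMk_left z y)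
  exact h1.smul_const y

theorem contDiff_gaussianField (hf : ContDiff ℝ 1 f) (hb : ∀ p, |f p| ≤ 1)
    (hd : ∀ p, ‖fderiv ℝ f p‖ ≤ C * (1 + ‖p.2‖)) : ContDiff ℝ 1 (gaussianField n f) := by
  rw [contDiff_one_iff_hasFDerivAt]
  refine ⟨_, ?_, hasFDerivAt_gaussianField hf hb hd⟩
  refine continuous_of_dominated (fun x ↦ (integrable_gaussianFieldDeriv hf hd x).1)
    (fun x ↦ .of_forall (norm_gaussianFieldDeriv_le hd x))
    (integrable_bound_gaussianFieldDeriv n C) (.of_forall fun y ↦ ?_)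
  exact (continuous_gaussianFieldDeriv hf).comp (by fun_prop : Continuous fun x ↦ (x, y))

theorem norm_fderiv_gaussianField_le (hf : ContDiff ℝ 1 f) (hb : ∀ p, |f p| ≤ 1)
    (hd : ∀ p, ‖fderiv ℝ f p‖ ≤ C * (1 + ‖p.2‖)) (x : EuclideanSpace ℝ (Fin n)) :
    ‖fderiv ℝ (gaussianField n f) x‖ ≤ ∫ y, C * (1 + ‖y‖) * ‖y‖ ∂gaussianMeasure n := by
  rw [(hasFDerivAt_gaussianField hf hb hd x).fderiv]
  exact norm_integral_le_of_norm_le (integrable_bound_gaussianFieldDeriv n C)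
    (.of_forall (norm_gaussianFieldDeriv_le hd x))

theorem admissible_smul_gaussianField (hf : ContDiff ℝ 1 f) (hb : ∀ p, |f p| ≤ 1)
    (hd : ∀ p, ‖fderiv ℝ f p‖ ≤ C * (1 + ‖p.2‖)) :
    Admissible n (fun x ↦ (√(2 / π))⁻¹ • gaussianField n f x) := by
  refine ⟨(contDiff_gaussianField hf hb hd).const_smul _, ⟨(√(2 / π))⁻¹ *
    ∫ y, C * (1 + ‖y‖) * ‖y‖ ∂gaussianMeasure n, fun x ↦ ?_⟩, fun x ↦ ?_⟩
  · rw [fderiv_fun_const_smul ((contDiff_gaussianField hf hb hd).differentiable (by simp) x),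
      norm_smul, Real.norm_of_nonneg (by positivity)]
    gcongr
    exact norm_fderiv_gaussianField_le hf hb hd x
  · rw [norm_smul, Real.norm_of_nonneg (by positivity)]
    exact inv_mul_le_one_of_le₀ (norm_gaussianField_le hf.continuous hb x) (by positivity)

/-- The Gaussian divergence of `gaussianField` is the average of the infinitesimal rotation. -/
theorem gdiv_gaussianField (hf : ContDiff ℝ 1 f) (hb : ∀ p, |f p| ≤ 1)
    (hd : ∀ p, ‖fderiv ℝ f p‖ ≤ C * (1 + ‖p.2‖)) (x : EuclideanSpace ℝ (Fin n)) :
    gdiv n (gaussianField n f) x =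
      ∫ y, fderiv ℝ f (x, y) (y, -x) ∂gaussianMeasure n := by
  have hint (v : EuclideanSpace ℝ (Fin n)) :
      Integrable (fun y ↦ gaussianFieldDeriv f x y v) (gaussianMeasure n) :=
    (integrable_gaussianFieldDeriv hf hd x).apply_continuousLinearMap v
  have hint' (i : Fin n) :
      Integrable (fun y ↦ gaussianFieldDeriv f x y (EuclideanSpace.single i 1) i)
        (gaussianMeasure n) :=
    (EuclideanSpace.proj (𝕜 := ℝ) i).integrable_comp (hint _)
  have h1 : ∑ i : Fin n, fderiv ℝ (gaussianField n f) x (EuclideanSpace.single i 1) i =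
      ∫ y, fderiv ℝ f (x, y) (y, 0) ∂gaussianMeasure n := by
    rw [(hasFDerivAt_gaussianField hf hb hd x).fderiv]
    have h2 (i : Fin n) : (∫ y, gaussianFieldDeriv f x y ∂gaussianMeasure n)
        (EuclideanSpace.single i 1) i =
        ∫ y, gaussianFieldDeriv f x y (EuclideanSpace.single i 1) i ∂gaussianMeasure n := by
      rw [ContinuousLinearMap.integral_apply (integrable_gaussianFieldDeriv hf hd x)]
      exact ((EuclideanSpace.proj (𝕜 := ℝ) i).integral_comp_comm (hint _)).symm
    simp_rw [h2]
    rw [← integral_finsetSum _ fun i _ ↦ hint' i]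
    congr 1 with y
    have h3 : y = ∑ i, y i • EuclideanSpace.single i (1 : ℝ) := by
      simpa using ((EuclideanSpace.basisFun (Fin n) ℝ).sum_repr y).symm
    have h4 : ((y, 0) : EuclideanSpace ℝ (Fin n) × EuclideanSpace ℝ (Fin n)) =
      ContinuousLinearMap.inl ℝ _ _ y := rfl
    rw [h4]
    simp only [gaussianFieldDeriv, ContinuousLinearMap.smulRight_apply, PiLp.smul_apply,
      smul_eq_mul, ContinuousLinearMap.comp_apply]
    generalize fderiv ℝ f (x, y) = L
    conv_rhs => rw [h3]
    simp_rw [map_sum, map_smul, smul_eq_mul, mul_comm]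
  have hF (y : EuclideanSpace ℝ (Fin n)) :
      HasFDerivAt (fun y ↦ f (x, y)) ((fderiv ℝ f (x, y)).comp (.inr ℝ _ _)) y :=
    ((hf.differentiable (by simp)) (x, y)).hasFDerivAt.comp y (hasFDerivAt_prodMk_right x y)
  have hcont : Continuous (fderiv ℝ f) := hf.continuous_fderiv (by simp)
  have hfx (v : EuclideanSpace ℝ (Fin n)) (g : EuclideanSpace ℝ (Fin n) → ℝ)
      (hg : Continuous g) (hgb : ∀ y, |g y| ≤ C * (1 + ‖y‖) * ‖v‖) :
      Integrable g (gaussianMeasure n) := by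
    have hB : Integrable (fun y ↦ C * (1 + ‖y‖) * ‖v‖) (gaussianMeasure n) := by
      have := (integrable_norm_pow_gaussianMeasure n 1)
      simp only [pow_one] at this
      exact (((integrable_const 1).add this).const_mul C).mul_const _
    exact hB.mono' hg.aestronglyMeasurable (.of_forall hgb)
  have hint0 (v : EuclideanSpace ℝ (Fin n)) :
      Integrable (fun y ↦ fderiv ℝ f (x, y) (0, v)) (gaussianMeasure n) := by
    refine hfx v _ (by fun_prop) fun y ↦ ?_
    have h5 := (fderiv ℝ f (x, y)).le_opNorm (0, v)
    rw [Prod.norm_mk, norm_zero, max_eq_right (norm_nonneg _)] at h5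
    exact h5.trans (by gcongr; exact hd (x, y))
  have h6 : ⟪x, gaussianField n f x⟫ = ∫ y, fderiv ℝ f (x, y) (0, x) ∂gaussianMeasure n := by
    rw [gaussianField, ← integral_inner (integrable_smul_id_gaussianMeasure hf.continuous hb x)]
    have h7 := integral_fderiv_gaussianMeasure (F := fun y ↦ f (x, y)) x
      (fun y ↦ (hF y).differentiableAt) ?_ ?_ ?_
    · simp_rw [(hF _).fderiv] at h7
      simp_rw [real_inner_smul_right]
      rw [← h7]
      rfl
    · simp_rw [(hF _).fderiv]
      exact hint0 x
    · have := (integrable_smul_id_gaussianMeasure hf.continuous hb x).const_inner (𝕜 := ℝ) x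
      simpa only [real_inner_smul_right] using this
    · exact (integrable_const (1 : ℝ)).mono' (Continuous.aestronglyMeasurable (by
        have := hf.continuous; fun_prop)) (.of_forall fun y ↦ hb _)
  rw [gdiv, h1, h6, ← integral_sub ?_ (hint0 x)]
  · congr 1 with y
    rw [← map_sub]
    simp
  · have := (integrable_bound_gaussianFieldDeriv n C)
    refine this.mono' (Continuous.aestronglyMeasurable (by fun_prop)) (.of_forall fun y ↦ ?_)
    have h5 := (fderiv ℝ f (x, y)).le_opNorm (y, 0)
    rw [Prod.norm_mk, norm_zero, max_eq_left (norm_nonneg _)] at h5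
    exact h5.trans (by gcongr; exact hd (x, y))

end gaussianField

/-- Duality formula for the `L¹` norm with smooth compactly supported test functions. -/
theorem integral_abs_le_of_forall_contDiff {E : Type*} [NormedAddCommGroup E] [NormedSpace ℝ E]
    [FiniteDimensional ℝ E] [MeasurableSpace E] [BorelSpace E] {μ : Measure E}
    [IsFiniteMeasure μ] {w : E → ℝ} (hw : Integrable w μ) {K : ℝ}
    (h : ∀ f : E → ℝ, HasCompactSupport f → ContDiff ℝ 1 f → (∀ x, |f x| ≤ 1) →
      ∫ x, w x * f x ∂μ ≤ K) :
    ∫ x, |w x| ∂μ ≤ K := by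
  refine le_of_forall_pos_le_add fun ε hε ↦ ?_
  set δ := ε / (2 + μ.real Set.univ) with hδ
  have hδ0 : 0 < δ := by positivity
  obtain ⟨g, hgc, hgs, hg⟩ := (memLp_one_iff_integrable.mpr hw).exist_eLpNorm_sub_le
    (by simp) le_rfl hδ0
  have hgi : Integrable g μ :=
    memLp_one_iff_integrable.mp (hgs.continuous.memLp_of_hasCompactSupport hgc)
  have hwg : ∫ x, |w x - g x| ∂μ ≤ δ := by
    have h1 := integral_norm_eq_lintegral_enorm (hw.sub hgi).1
    rw [eLpNorm_one_eq_lintegral_enorm] at hg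
    have h2 : ∫ x, |w x - g x| ∂μ = (∫⁻ x, ‖(w - g) x‖ₑ ∂μ).toReal := h1
    rw [h2]
    exact ENNReal.toReal_le_of_le_ofReal hδ0.le hg
  set f : E → ℝ := fun x ↦ g x / √(g x ^ 2 + δ ^ 2) with hf
  have hpos : ∀ x, 0 < √(g x ^ 2 + δ ^ 2) := fun x ↦ by positivity
  have habs : ∀ x, |g x| ≤ √(g x ^ 2 + δ ^ 2) := fun x ↦ by
    rw [← Real.sqrt_sq_eq_abs]
    exact Real.sqrt_le_sqrt (le_add_of_nonneg_right (sq_nonneg δ))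
  have hf1 : ∀ x, |f x| ≤ 1 := fun x ↦ by
    rw [hf, abs_div, abs_of_pos (hpos x)]
    exact div_le_one_of_le₀ (habs x) (hpos x).le
  have hfs : ContDiff ℝ 1 f := by
    have hg1 : ContDiff ℝ 1 g := hgs.of_le (by norm_cast)
    exact hg1.div (((hg1.pow 2).add contDiff_const).sqrt fun x ↦ by positivity)
      fun x ↦ (hpos x).ne'
  have hfc : HasCompactSupport f := by
    refine hgc.mono fun x hx ↦ ?_
    simp only [Function.mem_support] at hx ⊢
    contrapose! hx
    simp [hf, hx]
  have hgf : ∀ x, |g x| ≤ g x * f x + δ := fun x ↦ by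
    have hs : √(g x ^ 2 + δ ^ 2) ≤ |g x| + δ := by
      rw [Real.sqrt_le_left (by positivity)]
      nlinarith [abs_nonneg (g x), sq_abs (g x)]
    have h3 : g x * f x = |g x| ^ 2 / √(g x ^ 2 + δ ^ 2) := by
      rw [hf, sq_abs]; ring
    rw [h3, ← sub_le_iff_le_add, le_div_iff₀ (hpos x)]
    rcases le_total (|g x|) δ with h4 | h4
    · nlinarith [hpos x, sq_nonneg (g x), abs_nonneg (g x)]
    · nlinarith [hpos x, sq_nonneg (g x), abs_nonneg (g x)]
  have hfm : AEStronglyMeasurable f μ := hfs.continuous.aestronglyMeasurable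
  have hwf : Integrable (fun x ↦ w x * f x) μ :=
    hw.mul_bdd (c := 1) hfm (.of_forall hf1)
  have hpt : ∀ x, |w x| ≤ w x * f x + (2 * |w x - g x| + δ) := fun x ↦ by
    have h5 : |w x| ≤ |g x| + |w x - g x| := by
      have := abs_add_le (g x) (w x - g x); simpa using this
    have h6 : g x * f x ≤ w x * f x + |w x - g x| := by
      have h7 : (g x - w x) * f x ≤ |w x - g x| := by
        refine (le_abs_self _).trans ?_
        rw [abs_mul, abs_sub_comm]
        exact mul_le_of_le_one_right (abs_nonneg _) (hf1 x)
      linarith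
    linarith [hgf x]
  have hi1 : Integrable (fun x ↦ 2 * |w x - g x|) μ := (hw.sub hgi).abs.const_mul 2
  have hi2 : Integrable (fun x ↦ 2 * |w x - g x| + δ) μ := hi1.add (integrable_const δ)
  calc ∫ x, |w x| ∂μ ≤ ∫ x, (w x * f x + (2 * |w x - g x| + δ)) ∂μ :=
        integral_mono hw.abs (hwf.add hi2) hpt
    _ = ∫ x, w x * f x ∂μ + (2 * ∫ x, |w x - g x| ∂μ + μ.real Set.univ * δ) := by
        rw [integral_add hwf hi2, integral_add hi1 (integrable_const δ),
          integral_const_mul, integral_const, smul_eq_mul]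
    _ ≤ K + (2 * δ + μ.real Set.univ * δ) := by
        gcongr
        exact h f hfc hfs hf1
    _ = K + ε := by
        rw [← add_mul, hδ]
        field_simp

section rotation

/-- The infinitesimal generator of the rotations of `E × E`. -/
def rotationGenerator {E : Type*} [NormedAddCommGroup E] (p : E × E) : E × E := (p.2, -p.1)

theorem continuous_rotationGenerator {E : Type*} [NormedAddCommGroup E] :
    Continuous (rotationGenerator : E × E → E × E) := by
  unfold rotationGenerator; fun_prop

theorem norm_rotationGenerator {E : Type*} [NormedAddCommGroup E] (p : E × E) :
    ‖rotationGenerator p‖ = ‖p‖ := by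
  simp [rotationGenerator, Prod.norm_def, max_comm]

variable {E : Type*} [NormedAddCommGroup E] [NormedSpace ℝ E]

theorem hasDerivAt_rotation (p : E × E) (θ : ℝ) :
    HasDerivAt (fun θ : ℝ ↦ ContinuousLinearMap.rotation θ p)
      (rotationGenerator (ContinuousLinearMap.rotation θ p)) θ := by
  have h1 : HasDerivAt (fun θ : ℝ ↦ Real.cos θ • p.1 + Real.sin θ • p.2)
      (-Real.sin θ • p.1 + Real.cos θ • p.2) θ :=
    ((Real.hasDerivAt_cos θ).smul_const p.1).add ((Real.hasDerivAt_sin θ).smul_const p.2)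
  have h2 : HasDerivAt (fun θ : ℝ ↦ -Real.sin θ • p.1 + Real.cos θ • p.2)
      (-(Real.cos θ • p.1 + Real.sin θ • p.2)) θ := by
    refine (((Real.hasDerivAt_sin θ).neg.smul_const p.1).add
      ((Real.hasDerivAt_cos θ).smul_const p.2)).congr_deriv ?_
    module
  exact h1.prodMk h2

theorem rotation_rotationGenerator (θ : ℝ) (p : E × E) :
    ContinuousLinearMap.rotation θ (rotationGenerator p) =
      rotationGenerator (ContinuousLinearMap.rotation θ p) := by
  simp [rotationGenerator, ContinuousLinearMap.rotation_apply, add_comm]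

theorem rotation_neg_rotation (θ : ℝ) (p : E × E) :
    ContinuousLinearMap.rotation (-θ) (ContinuousLinearMap.rotation θ p) = p := by
  ext
  · simp only [ContinuousLinearMap.rotation_apply, Real.cos_neg, Real.sin_neg]
    match_scalars <;> nlinarith [Real.sin_sq_add_cos_sq θ]
  · simp only [ContinuousLinearMap.rotation_apply, Real.cos_neg, Real.sin_neg]
    match_scalars <;> nlinarith [Real.sin_sq_add_cos_sq θ]

theorem norm_rotation_apply_le (θ : ℝ) (p : E × E) :
    ‖ContinuousLinearMap.rotation θ p‖ ≤ 2 * ‖p‖ := by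
  have hs (a : E) : ‖Real.sin θ • a‖ ≤ ‖a‖ := by
    rw [norm_smul]; exact mul_le_of_le_one_left (norm_nonneg _) (Real.abs_sin_le_one θ)
  have hc (a : E) : ‖Real.cos θ • a‖ ≤ ‖a‖ := by
    rw [norm_smul]; exact mul_le_of_le_one_left (norm_nonneg _) (Real.abs_cos_le_one θ)
  have h1 := norm_fst_le p
  have h2 := norm_snd_le p
  rw [ContinuousLinearMap.rotation_apply, Prod.norm_mk]
  refine max_le ((norm_add_le _ _).trans ?_) ((norm_add_le _ _).trans ?_)
  · linarith [hc p.1, hs p.2]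
  · rw [neg_smul, norm_neg]
    linarith [hs p.1, hc p.2]

end rotation

section totVar

variable {n : ℕ} {f : EuclideanSpace ℝ (Fin n) × EuclideanSpace ℝ (Fin n) → ℝ}
  {u : EuclideanSpace ℝ (Fin n) → ℝ}

theorem measurePreserving_rotation (n : ℕ) (θ : ℝ) :
    MeasurePreserving (ContinuousLinearMap.rotation θ)
      ((gaussianMeasure n).prod (gaussianMeasure n))
      ((gaussianMeasure n).prod (gaussianMeasure n)) :=
  ⟨(ContinuousLinearMap.rotation θ).continuous.measurable, map_rotation_gaussianMeasure_prod n θ⟩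

theorem integrable_comp_rotation_fst (hu : Integrable u (gaussianMeasure n)) (θ : ℝ) :
    Integrable (fun p ↦ u (ContinuousLinearMap.rotation θ p).1)
      ((gaussianMeasure n).prod (gaussianMeasure n)) := by
  have h : Integrable (fun p : EuclideanSpace ℝ (Fin n) × EuclideanSpace ℝ (Fin n) ↦ u p.1)
    ((gaussianMeasure n).prod (gaussianMeasure n)) := hu.comp_fst _
  exact (measurePreserving_rotation n θ).integrable_comp_of_integrable h

theorem integral_mul_comp_rotation (hu : Integrable u (gaussianMeasure n)) (hf : Continuous f)
    (θ : ℝ) :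
    ∫ p, u p.1 * f (ContinuousLinearMap.rotation θ p)
        ∂((gaussianMeasure n).prod (gaussianMeasure n)) =
      ∫ p, u (ContinuousLinearMap.rotation (-θ) p).1 * f p
        ∂((gaussianMeasure n).prod (gaussianMeasure n)) := by
  have h := integral_map (μ := (gaussianMeasure n).prod (gaussianMeasure n))
    (φ := ContinuousLinearMap.rotation θ)
    (f := fun p ↦ u (ContinuousLinearMap.rotation (-θ) p).1 * f p)
    (ContinuousLinearMap.rotation θ).continuous.aemeasurable ?_
  · rw [map_rotation_gaussianMeasure_prod] at h
    rw [h]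
    simp_rw [rotation_neg_rotation]
  · rw [map_rotation_gaussianMeasure_prod]
    exact (integrable_comp_rotation_fst hu (-θ)).1.mul hf.aestronglyMeasurable

theorem hasDerivAt_integral_rotation (hu : Integrable u (gaussianMeasure n))
    (hf : ContDiff ℝ 1 f) (hb : ∀ p, |f p| ≤ 1)
    {B : EuclideanSpace ℝ (Fin n) × EuclideanSpace ℝ (Fin n) → ℝ}
    (hB : Integrable B ((gaussianMeasure n).prod (gaussianMeasure n)))
    (hbound : ∀ θ p, |u p.1 * fderiv ℝ f (ContinuousLinearMap.rotation θ p)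
      (rotationGenerator (ContinuousLinearMap.rotation θ p))| ≤ B p) (θ : ℝ) :
    Integrable (fun p ↦ u p.1 * fderiv ℝ f (ContinuousLinearMap.rotation θ p)
      (rotationGenerator (ContinuousLinearMap.rotation θ p)))
      ((gaussianMeasure n).prod (gaussianMeasure n)) ∧
    HasDerivAt (fun θ ↦ ∫ p, u p.1 * f (ContinuousLinearMap.rotation θ p)
        ∂((gaussianMeasure n).prod (gaussianMeasure n)))
      (∫ p, u p.1 * fderiv ℝ f (ContinuousLinearMap.rotation θ p)
        (rotationGenerator (ContinuousLinearMap.rotation θ p))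
        ∂((gaussianMeasure n).prod (gaussianMeasure n))) θ := by
  have hu2 : Integrable (fun p : EuclideanSpace ℝ (Fin n) × EuclideanSpace ℝ (Fin n) ↦ u p.1)
    ((gaussianMeasure n).prod (gaussianMeasure n)) := hu.comp_fst _
  have hfc (θ : ℝ) : Continuous fun p ↦ f (ContinuousLinearMap.rotation θ p) :=
    hf.continuous.comp (ContinuousLinearMap.rotation θ).continuous
  have hfd : Continuous (fderiv ℝ f) := hf.continuous_fderiv (by simp)
  refine hasDerivAt_integral_of_dominated_loc_of_deriv_le (s := Set.univ) univ_mem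
    (.of_forall fun θ ↦ hu2.1.mul (hfc θ).aestronglyMeasurable)
    (hu2.mul_bdd (c := 1) (hfc θ).aestronglyMeasurable (.of_forall fun p ↦ hb _))
    (hu2.1.mul (Continuous.aestronglyMeasurable ?_)) (.of_forall fun p θ _ ↦ hbound θ p) hB
    (.of_forall fun p θ _ ↦ ?_)
  · have h1 := (ContinuousLinearMap.rotation (E := EuclideanSpace ℝ (Fin n)) θ).continuous
    exact (hfd.comp h1).clm_apply (continuous_rotationGenerator.comp h1)
  · exact (((hf.differentiable (by simp)) _).hasFDerivAt.comp_hasDerivAt θ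
      (hasDerivAt_rotation p θ)).const_mul _

theorem integral_mul_fderiv_rotationGenerator (hf : ContDiff ℝ 1 f) (hb : ∀ p, |f p| ≤ 1) {C : ℝ}
    (hd : ∀ p, ‖fderiv ℝ f p‖ ≤ C * (1 + ‖p.2‖))
    (hint : Integrable (fun p ↦ u p.1 * fderiv ℝ f p (rotationGenerator p))
      ((gaussianMeasure n).prod (gaussianMeasure n))) :
    ∫ p, u p.1 * fderiv ℝ f p (rotationGenerator p)
        ∂((gaussianMeasure n).prod (gaussianMeasure n)) =
      ∫ x, u x * gdiv n (gaussianField n f) x ∂gaussianMeasure n := by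
  rw [integral_prod _ hint]
  simp_rw [gdiv_gaussianField hf hb hd, integral_const_mul, rotationGenerator]

theorem gdiv_const_smul {φ : EuclideanSpace ℝ (Fin n) → EuclideanSpace ℝ (Fin n)}
    (hφ : Differentiable ℝ φ) (c : ℝ) (x : EuclideanSpace ℝ (Fin n)) :
    gdiv n (fun x ↦ c • φ x) x = c * gdiv n φ x := by
  simp only [gdiv]
  rw [fderiv_fun_const_smul (hφ x)]
  simp [real_inner_smul_right, mul_sub, Finset.mul_sum]

theorem integral_mul_gdiv_le_totVar {φ : EuclideanSpace ℝ (Fin n) → EuclideanSpace ℝ (Fin n)}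
    (hφ : Admissible n φ) (hfin : totVar n u ≠ ⊤) :
    ∫ x, u x * gdiv n φ x ∂gaussianMeasure n ≤ (totVar n u).toReal := by
  rw [← ENNReal.ofReal_le_iff_le_toReal hfin]
  exact le_iSup₂_of_le φ hφ le_rfl

theorem integral_mul_gdiv_gaussianField_le (hf : ContDiff ℝ 1 f) (hb : ∀ p, |f p| ≤ 1) {C : ℝ}
    (hd : ∀ p, ‖fderiv ℝ f p‖ ≤ C * (1 + ‖p.2‖)) (hfin : totVar n u ≠ ⊤) :
    ∫ x, u x * gdiv n (gaussianField n f) x ∂gaussianMeasure n ≤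
      √(2 / π) * (totVar n u).toReal := by
  have h := integral_mul_gdiv_le_totVar (admissible_smul_gaussianField hf hb hd) hfin
  simp_rw [gdiv_const_smul ((contDiff_gaussianField hf hb hd).differentiable (by simp)),
    mul_left_comm (u _), integral_const_mul] at h
  rwa [inv_mul_le_iff₀ (by positivity)] at h

/-- The Gaussian total variation controls the increments of `u` along rotations. -/
theorem integral_abs_rotation_sub_le (hu : Integrable u (gaussianMeasure n))
    (hfin : totVar n u ≠ ⊤) {θ : ℝ} (hθ : 0 ≤ θ) :
    ∫ p, |u (ContinuousLinearMap.rotation (-θ) p).1 - u p.1|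
        ∂((gaussianMeasure n).prod (gaussianMeasure n)) ≤
      √(2 / π) * (totVar n u).toReal * θ := by
  have hu2 : Integrable (fun p : EuclideanSpace ℝ (Fin n) × EuclideanSpace ℝ (Fin n) ↦ u p.1)
    ((gaussianMeasure n).prod (gaussianMeasure n)) := hu.comp_fst _
  refine integral_abs_le_of_forall_contDiff ((integrable_comp_rotation_fst hu (-θ)).sub hu2)
    fun f hfc hf hb ↦ ?_
  have hfd : Continuous (fderiv ℝ f) := hf.continuous_fderiv (by simp)
  obtain ⟨C, hC⟩ := hfd.bounded_above_of_compact_support (hfc.fderiv ℝ)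
  have hC0 : 0 ≤ C := (norm_nonneg _).trans (hC 0)
  obtain ⟨K, hK⟩ := (hfd.clm_apply continuous_rotationGenerator).bounded_above_of_compact_support
    ((hfc.fderiv ℝ).mono fun p hp ↦ by
      simp only [Function.mem_support] at hp ⊢
      contrapose! hp
      simp [hp])
  have hderiv := hasDerivAt_integral_rotation hu hf hb (hu2.norm.mul_const K) (fun θ p ↦ by
    rw [abs_mul]
    exact mul_le_mul_of_nonneg_left (hK _) (abs_nonneg _))
  have hle (θ : ℝ) : ∫ p, u p.1 * fderiv ℝ f (ContinuousLinearMap.rotation θ p)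
        (rotationGenerator (ContinuousLinearMap.rotation θ p))
        ∂((gaussianMeasure n).prod (gaussianMeasure n)) ≤ √(2 / π) * (totVar n u).toReal := by
    set g : EuclideanSpace ℝ (Fin n) × EuclideanSpace ℝ (Fin n) → ℝ :=
      fun p ↦ f (ContinuousLinearMap.rotation θ p) with hg
    have hg1 : ContDiff ℝ 1 g :=
      hf.comp (ContinuousLinearMap.rotation (E := EuclideanSpace ℝ (Fin n)) θ).contDiff
    have hgd (p) : fderiv ℝ g p =
        (fderiv ℝ f (ContinuousLinearMap.rotation θ p)).comp (ContinuousLinearMap.rotation θ) :=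
      ((hf.differentiable (by simp) _).hasFDerivAt.comp p
        (ContinuousLinearMap.rotation (E := EuclideanSpace ℝ (Fin n)) θ).hasFDerivAt).fderiv
    have hgen (p) : fderiv ℝ f (ContinuousLinearMap.rotation θ p)
        (rotationGenerator (ContinuousLinearMap.rotation θ p)) =
        fderiv ℝ g p (rotationGenerator p) := by
      rw [hgd, ContinuousLinearMap.comp_apply, rotation_rotationGenerator]
    have hgb : ∀ p, ‖fderiv ℝ g p‖ ≤ (C * 2) * (1 + ‖p.2‖) := fun p ↦ by
      rw [hgd]
      refine (ContinuousLinearMap.opNorm_comp_le _ _).trans ?_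
      have h1 : ‖ContinuousLinearMap.rotation (E := EuclideanSpace ℝ (Fin n)) θ‖ ≤ 2 :=
        ContinuousLinearMap.opNorm_le_bound _ (by norm_num) (norm_rotation_apply_le θ)
      calc _ ≤ C * 2 := mul_le_mul (hC _) h1 (norm_nonneg _) hC0
        _ ≤ _ := le_mul_of_one_le_right (by positivity) (by linarith [norm_nonneg p.2])
    have hint := (hderiv θ).1
    simp_rw [hgen] at hint ⊢
    rw [integral_mul_fderiv_rotationGenerator hg1 (fun p ↦ hb _) hgb hint]
    exact integral_mul_gdiv_gaussianField_le hg1 (fun p ↦ hb _) hgb hfin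
  have hmain := image_sub_le_mul_sub_of_deriv_le (fun θ ↦ (hderiv θ).2.differentiableAt)
    (fun θ ↦ by rw [(hderiv θ).2.deriv]; exact hle θ) hθ
  rw [sub_zero, integral_mul_comp_rotation hu hf.continuous,
    integral_mul_comp_rotation hu hf.continuous, ← integral_sub] at hmain
  · simpa [sub_mul, ContinuousLinearMap.rotation_apply] using hmain
  · exact (integrable_comp_rotation_fst hu _).mul_bdd (c := 1)
      hf.continuous.aestronglyMeasurable (.of_forall hb)
  · exact (integrable_comp_rotation_fst hu _).mul_bdd (c := 1)
      hf.continuous.aestronglyMeasurable (.of_forall hb)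

end totVar

/-- The odd sigmoid `a ↦ 2 Φ(a) - 1`, with `Φ` the standard Gaussian distribution function. -/
noncomputable def gaussianSigmoid (a : ℝ) : ℝ :=
  ∫ r in (0 : ℝ)..a, √(2 / π) * Real.exp (-(1 / 2) * r ^ 2)

theorem hasDerivAt_gaussianSigmoid (a : ℝ) :
    HasDerivAt gaussianSigmoid (√(2 / π) * Real.exp (-(1 / 2) * a ^ 2)) a :=
  (Continuous.integral_hasStrictDerivAt
    (f := fun r : ℝ ↦ √(2 / π) * Real.exp (-(1 / 2) * r ^ 2)) (by fun_prop) 0 a).hasDerivAt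

theorem contDiff_gaussianSigmoid : ContDiff ℝ 1 gaussianSigmoid := by
  rw [contDiff_one_iff_deriv]
  refine ⟨fun a ↦ (hasDerivAt_gaussianSigmoid a).differentiableAt, ?_⟩
  rw [funext fun a ↦ (hasDerivAt_gaussianSigmoid a).deriv]
  fun_prop

theorem gaussianSigmoid_neg (a : ℝ) : gaussianSigmoid (-a) = -gaussianSigmoid a := by
  have h := intervalIntegral.integral_comp_neg (a := 0) (b := a)
    (fun r : ℝ ↦ √(2 / π) * Real.exp (-(1 / 2) * r ^ 2))
  simp only [even_two.neg_pow, neg_zero] at h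
  rw [gaussianSigmoid, intervalIntegral.integral_symm, ← h, gaussianSigmoid]

theorem abs_gaussianSigmoid_le_one (a : ℝ) : |gaussianSigmoid a| ≤ 1 := by
  wlog ha : 0 ≤ a generalizing a
  · rw [← abs_neg, ← gaussianSigmoid_neg]
    exact this _ (by linarith)
  have hnn (r : ℝ) : 0 ≤ √(2 / π) * Real.exp (-(1 / 2) * r ^ 2) := by positivity
  rw [gaussianSigmoid, abs_of_nonneg (intervalIntegral.integral_nonneg ha fun r _ ↦ hnn r),
    intervalIntegral.integral_of_le ha]
  calc _ ≤ ∫ r in Set.Ioi (0 : ℝ), √(2 / π) * Real.exp (-(1 / 2) * r ^ 2) :=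
        setIntegral_mono_set
          (((integrable_exp_neg_mul_sq (b := 1 / 2) (by norm_num)).const_mul _).integrableOn)
          (.of_forall hnn) Set.Ioc_subset_Ioi_self.eventuallyLE
    _ = 1 := by
        rw [integral_const_mul, integral_gaussian_Ioi, mul_div_assoc', ← Real.sqrt_mul (by positivity),
          show 2 / π * (π / (1 / 2)) = 2 ^ 2 by field_simp, Real.sqrt_sq (by norm_num)]
        norm_num

theorem sqrt_two_div_pi_le_one : √(2 / π) ≤ 1 := by
  rw [Real.sqrt_le_left zero_le_one, one_pow, div_le_one pi_pos]
  exact two_le_pi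

theorem abs_sqrt_mul_exp_le_one (a : ℝ) : |√(2 / π) * Real.exp (-(1 / 2) * a ^ 2)| ≤ 1 := by
  rw [abs_of_nonneg (by positivity)]
  refine mul_le_one₀ sqrt_two_div_pi_le_one (Real.exp_pos _).le ?_
  rw [Real.exp_le_one_iff]
  nlinarith [sq_nonneg a]

theorem integral_exp_neg_sq_gaussianReal (s : NNReal) :
    ∫ r, Real.exp (-(1 / 2) * r ^ 2) ∂gaussianReal 0 s = (√(1 + s))⁻¹ := by
  rcases eq_or_ne s 0 with rfl | hs
  · simp
  have hs' : (0 : ℝ) < s := by positivity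
  rw [integral_gaussianReal_eq_integral_smul hs]
  have h (r : ℝ) : gaussianPDFReal 0 s r • Real.exp (-(1 / 2) * r ^ 2) =
      (√(2 * π * s))⁻¹ * Real.exp (-((1 + s) / (2 * s)) * r ^ 2) := by
    simp only [gaussianPDFReal, smul_eq_mul, mul_assoc, ← Real.exp_add]
    congr 3
    field_simp
    ring
  simp_rw [h]
  rw [integral_const_mul, integral_gaussian, ← Real.sqrt_inv, ← Real.sqrt_mul (by positivity),
    ← Real.sqrt_inv]
  congr 1
  field_simp

section sigmoidField

variable {n : ℕ}

theorem hasFDerivAt_gaussianSigmoid_inner (a y : EuclideanSpace ℝ (Fin n)) :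
    HasFDerivAt (fun y ↦ gaussianSigmoid ⟪a, y⟫)
      ((√(2 / π) * Real.exp (-(1 / 2) * ⟪a, y⟫ ^ 2)) • innerSL ℝ a) y :=
  (hasDerivAt_gaussianSigmoid _).comp_hasFDerivAt y (innerSL ℝ a).hasFDerivAt

theorem integral_gaussianSigmoid_smul (a : EuclideanSpace ℝ (Fin n)) :
    ∫ y, gaussianSigmoid ⟪a, y⟫ • y ∂gaussianMeasure n =
      (√(2 / π) * (√(1 + ‖a‖ ^ 2))⁻¹) • a := by
  have hcont : Continuous fun y : EuclideanSpace ℝ (Fin n) ↦ gaussianSigmoid ⟪a, y⟫ :=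
    contDiff_gaussianSigmoid.continuous.comp (by fun_prop)
  have hint : Integrable (fun y ↦ gaussianSigmoid ⟪a, y⟫ • y) (gaussianMeasure n) :=
    integrable_smul_id_gaussianMeasure (f := fun p ↦ gaussianSigmoid ⟪a, p.2⟫)
      (hcont.comp continuous_snd) (fun p ↦ abs_gaussianSigmoid_le_one _) 0
  refine ext_inner_left ℝ fun v ↦ ?_
  have h1 : ∫ y, Real.exp (-(1 / 2) * ⟪a, y⟫ ^ 2) ∂gaussianMeasure n =
      (√(1 + ‖a‖ ^ 2))⁻¹ := by
    have := integral_exp_neg_sq_gaussianReal (‖a‖₊ ^ 2)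
    rw [← map_inner_gaussianMeasure, integral_map (by fun_prop) (by fun_prop)] at this
    simpa using this
  have hd (y : EuclideanSpace ℝ (Fin n)) : fderiv ℝ (fun y ↦ gaussianSigmoid ⟪a, y⟫) y v =
      √(2 / π) * ⟪a, v⟫ * Real.exp (-(1 / 2) * ⟪a, y⟫ ^ 2) := by
    rw [(hasFDerivAt_gaussianSigmoid_inner a y).fderiv]
    simp
    ring
  have h2 := integral_fderiv_gaussianMeasure (F := fun y ↦ gaussianSigmoid ⟪a, y⟫) v
    (fun y ↦ (hasFDerivAt_gaussianSigmoid_inner a y).differentiableAt) ?_ ?_ ?_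
  · rw [← integral_inner hint, real_inner_smul_right]
    simp_rw [real_inner_smul_right]
    rw [← h2]
    simp_rw [hd]
    rw [integral_const_mul, h1, real_inner_comm]
    ring
  · simp_rw [hd]
    refine Integrable.const_mul (.of_bound (by fun_prop) 1 (.of_forall fun y ↦ ?_)) _
    rw [Real.norm_of_nonneg (Real.exp_pos _).le, Real.exp_le_one_iff]
    nlinarith [sq_nonneg ⟪a, y⟫]
  · exact (hint.const_inner v).congr (.of_forall fun y ↦ real_inner_smul_right _ _ _)
  · exact .of_bound hcont.aestronglyMeasurable 1
      (.of_forall fun y ↦ abs_gaussianSigmoid_le_one _)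

theorem exists_gaussianField_eq_smul {φ : EuclideanSpace ℝ (Fin n) → EuclideanSpace ℝ (Fin n)}
    (hφ : Admissible n φ) {t : ℝ} (ht0 : 0 < t) (ht1 : t < 1) :
    ∃ (f : EuclideanSpace ℝ (Fin n) × EuclideanSpace ℝ (Fin n) → ℝ) (C : ℝ),
      ContDiff ℝ 1 f ∧ (∀ p, |f p| ≤ 1) ∧ (∀ p, ‖fderiv ℝ f p‖ ≤ C * (1 + ‖p.2‖)) ∧
      ∀ x, gaussianField n f x = (√(2 / π) * t) • φ x := by
  obtain ⟨hφ1, ⟨M, hM⟩, hφb⟩ := hφ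
  have hM0 : 0 ≤ M := (norm_nonneg _).trans (hM 0)
  set α : EuclideanSpace ℝ (Fin n) → EuclideanSpace ℝ (Fin n) :=
    fun v ↦ (t * (√(1 - t ^ 2 * ‖v‖ ^ 2))⁻¹) • v with hα
  have hpos {v : EuclideanSpace ℝ (Fin n)} (hv : v ∈ Metric.ball 0 t⁻¹) :
      0 < 1 - t ^ 2 * ‖v‖ ^ 2 := by
    rw [mem_ball_zero_iff] at hv
    have h : t * ‖v‖ < 1 := (mul_lt_mul_of_pos_left hv ht0).trans_eq (mul_inv_cancel₀ ht0.ne')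
    nlinarith [mul_nonneg ht0.le (norm_nonneg v)]
  have hball {v : EuclideanSpace ℝ (Fin n)} (hv : ‖v‖ ≤ 1) : v ∈ Metric.ball 0 t⁻¹ :=
    mem_ball_zero_iff.mpr (hv.trans_lt ((one_lt_inv₀ ht0).mpr ht1))
  have hαd : ContDiffOn ℝ 1 α (Metric.ball 0 t⁻¹) := by
    refine ContDiffOn.smul (contDiffOn_const.mul (ContDiffOn.inv (ContDiffOn.sqrt ?_ ?_) ?_))
      contDiffOn_id
    · exact (contDiff_const.sub (contDiff_const.mul (contDiff_norm_sq ℝ))).contDiffOn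
    · exact fun v hv ↦ (hpos hv).ne'
    · exact fun v hv ↦ (Real.sqrt_pos.mpr (hpos hv)).ne'
  have hsub : Metric.closedBall (0 : EuclideanSpace ℝ (Fin n)) 1 ⊆ Metric.ball 0 t⁻¹ :=
    fun v hv ↦ hball (mem_closedBall_zero_iff.mp hv)
  obtain ⟨K, hK⟩ := (isCompact_closedBall (0 : EuclideanSpace ℝ (Fin n)) 1).exists_bound_of_continuousOn
    ((hαd.continuousOn_fderiv_of_isOpen Metric.isOpen_ball le_rfl).mono hsub)
  obtain ⟨N, hN⟩ := (isCompact_closedBall (0 : EuclideanSpace ℝ (Fin n)) 1).exists_bound_of_continuousOn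
    (hαd.continuousOn.mono hsub)
  have hK0 : 0 ≤ K := (norm_nonneg _).trans (hK 0 (by simp))
  have hN0 : 0 ≤ N := (norm_nonneg _).trans (hN 0 (by simp))
  have hφm (x) : φ x ∈ Metric.closedBall 0 1 := mem_closedBall_zero_iff.mpr (hφb x)
  have hαat (x) : ContDiffAt ℝ 1 α (φ x) :=
    hαd.contDiffAt (Metric.isOpen_ball.mem_nhds (hsub (hφm x)))
  have hA : ContDiff ℝ 1 fun x ↦ α (φ x) :=
    contDiff_iff_contDiffAt.mpr fun x ↦ (hαat x).comp x hφ1.contDiffAt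
  have hAd (x) : HasFDerivAt (fun x ↦ α (φ x)) ((fderiv ℝ α (φ x)).comp (fderiv ℝ φ x)) x :=
    ((hαat x).differentiableAt (by simp)).hasFDerivAt.comp x
      (hφ1.differentiable (by simp) x).hasFDerivAt
  refine ⟨fun p ↦ gaussianSigmoid ⟪α (φ p.1), p.2⟫, K * M + N,
    contDiff_gaussianSigmoid.comp ((hA.comp contDiff_fst).inner ℝ contDiff_snd),
    fun p ↦ abs_gaussianSigmoid_le_one _, fun p ↦ ?_, fun x ↦ ?_⟩
  · have hin := ((hAd p.1).comp p hasFDerivAt_fst).inner ℝ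
      (hasFDerivAt_snd (𝕜 := ℝ) (p := p))
    have h := (hasDerivAt_gaussianSigmoid _).comp_hasFDerivAt p hin
    refine ContinuousLinearMap.opNorm_le_bound _ (by positivity) fun q ↦ ?_
    have hq : fderiv ℝ (fun p : EuclideanSpace ℝ (Fin n) × EuclideanSpace ℝ (Fin n) ↦
        gaussianSigmoid ⟪α (φ p.1), p.2⟫) p q =
        (√(2 / π) * Real.exp (-(1 / 2) * ⟪α (φ p.1), p.2⟫ ^ 2)) *
          (⟪α (φ p.1), q.2⟫ + ⟪fderiv ℝ α (φ p.1) (fderiv ℝ φ p.1 q.1), p.2⟫) :=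
      congrArg (fun L ↦ L q) h.fderiv
    have h1 : |⟪α (φ p.1), q.2⟫| ≤ N * ‖q‖ :=
      (abs_real_inner_le_norm _ _).trans
        (mul_le_mul (hN _ (hφm _)) (norm_snd_le q) (norm_nonneg _) hN0)
    have h2 : |⟪fderiv ℝ α (φ p.1) (fderiv ℝ φ p.1 q.1), p.2⟫| ≤ K * (M * ‖q‖) * ‖p.2‖ := by
      refine (abs_real_inner_le_norm _ _).trans ?_
      gcongr
      refine (ContinuousLinearMap.le_of_opNorm_le _ (hK _ (hφm _)) _).trans ?_
      gcongr
      refine (ContinuousLinearMap.le_of_opNorm_le _ (hM _) _).trans ?_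
      gcongr
      exact norm_fst_le q
    rw [hq, Real.norm_eq_abs, abs_mul]
    refine (mul_le_of_le_one_left (abs_nonneg _) (abs_sqrt_mul_exp_le_one _)).trans
      ((abs_add_le _ _).trans ((add_le_add h1 h2).trans ?_))
    have h3 : 0 ≤ K * M * ‖q‖ := by positivity
    have h4 : 0 ≤ N * ‖q‖ * ‖p.2‖ := by positivity
    linarith
  · refine (integral_gaussianSigmoid_smul (α (φ x))).trans ?_
    simp only [hα]
    have hp := hpos (hsub (hφm x))
    set w := 1 - t ^ 2 * ‖φ x‖ ^ 2 with hw
    have h1 : 1 + ‖(t * (√w)⁻¹) • φ x‖ ^ 2 = w⁻¹ := by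
      rw [norm_smul, mul_pow, Real.norm_eq_abs, sq_abs, mul_pow, inv_pow, Real.sq_sqrt hp.le]
      field_simp
      rw [hw]; ring
    simp only [h1, smul_smul, Real.sqrt_inv, inv_inv]
    congr 1
    have := Real.sqrt_pos.mpr hp
    field_simp

end sigmoidField

section lowerBound

variable {n : ℕ} {u : EuclideanSpace ℝ (Fin n) → ℝ}

/-- The `L¹` norm of the increment of `u` along the rotation of angle `-θ`. -/
noncomputable def rotationIncrement (n : ℕ) (u : EuclideanSpace ℝ (Fin n) → ℝ) (θ : ℝ) : ℝ≥0∞ :=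
  ∫⁻ p, ‖u (ContinuousLinearMap.rotation (-θ) p).1 - u p.1‖ₑ
    ∂((gaussianMeasure n).prod (gaussianMeasure n))

theorem ofReal_integral_mul_rotation_sub_le (hu : Integrable u (gaussianMeasure n))
    {f : EuclideanSpace ℝ (Fin n) × EuclideanSpace ℝ (Fin n) → ℝ}
    (hf : Continuous f) (hb : ∀ p, |f p| ≤ 1) (θ : ℝ) :
    ENNReal.ofReal (∫ p, u p.1 * f (ContinuousLinearMap.rotation θ p)
        ∂((gaussianMeasure n).prod (gaussianMeasure n)) -
      ∫ p, u p.1 * f (ContinuousLinearMap.rotation 0 p)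
        ∂((gaussianMeasure n).prod (gaussianMeasure n))) ≤ rotationIncrement n u θ := by
  have hi (θ : ℝ) : Integrable (fun p ↦ u (ContinuousLinearMap.rotation θ p).1 * f p)
      ((gaussianMeasure n).prod (gaussianMeasure n)) :=
    (integrable_comp_rotation_fst hu _).mul_bdd (c := 1) hf.aestronglyMeasurable (.of_forall hb)
  rw [integral_mul_comp_rotation hu hf, integral_mul_comp_rotation hu hf,
    ← integral_sub (hi _) (hi _)]
  refine (Real.ofReal_le_enorm _).trans ((enorm_integral_le_lintegral_enorm _).trans
    (lintegral_mono fun p ↦ ?_))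
  have h0 : (ContinuousLinearMap.rotation (-0) p).1 = p.1 := by
    simp [ContinuousLinearMap.rotation_apply]
  rw [h0, ← sub_mul, enorm_mul]
  refine mul_le_of_le_one_right' ?_
  rw [Real.enorm_eq_ofReal_abs, ENNReal.ofReal_le_one]
  exact hb p

theorem ofReal_integral_mul_gdiv_le_liminf (hu : Integrable u (gaussianMeasure n))
    (hu1 : ∀ x, |u x| ≤ 1) {φ : EuclideanSpace ℝ (Fin n) → EuclideanSpace ℝ (Fin n)}
    (hφ : Admissible n φ) {t : ℝ} (ht0 : 0 < t) (ht1 : t < 1) :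
    ENNReal.ofReal (√(2 / π) * t * ∫ x, u x * gdiv n φ x ∂gaussianMeasure n) ≤
      liminf (fun k : ℕ ↦ ENNReal.ofReal (k + 1) * rotationIncrement n u (1 / (k + 1))) atTop := by
  obtain ⟨f, C, hf, hb, hd, hfield⟩ := exists_gaussianField_eq_smul hφ ht0 ht1
  have hC0 : 0 ≤ C := by simpa using (norm_nonneg _).trans (hd 0)
  have hBi : Integrable (fun p : EuclideanSpace ℝ (Fin n) × EuclideanSpace ℝ (Fin n) ↦
      C * ((2 * (‖p.1‖ ^ 1 + ‖p.2‖ ^ 1)) + 4 * (‖p.1‖ ^ 2 + ‖p.2‖ ^ 2)))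
      ((gaussianMeasure n).prod (gaussianMeasure n)) := by
    have h1 (k : ℕ) : Integrable (fun p : EuclideanSpace ℝ (Fin n) × EuclideanSpace ℝ (Fin n) ↦
        ‖p.1‖ ^ k + ‖p.2‖ ^ k) ((gaussianMeasure n).prod (gaussianMeasure n)) :=
      ((integrable_norm_pow_gaussianMeasure n k).comp_fst _).add
        ((integrable_norm_pow_gaussianMeasure n k).comp_snd _)
    exact (((h1 1).const_mul 2).add ((h1 2).const_mul 4)).const_mul C
  obtain ⟨hint, hderiv⟩ := hasDerivAt_integral_rotation hu hf hb hBi (fun θ p ↦ by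
    rw [abs_mul]
    refine (mul_le_of_le_one_left (abs_nonneg _) (hu1 _)).trans ?_
    have hr := norm_rotation_apply_le θ p
    have hr2 := (norm_snd_le (ContinuousLinearMap.rotation θ p)).trans hr
    have hp : ‖p‖ ≤ ‖p.1‖ + ‖p.2‖ :=
      max_le (le_add_of_nonneg_right (norm_nonneg _)) (le_add_of_nonneg_left (norm_nonneg _))
    have hp2 : ‖p‖ ^ 2 ≤ ‖p.1‖ ^ 2 + ‖p.2‖ ^ 2 := by
      rw [Prod.norm_def]
      rcases max_choice ‖p.1‖ ‖p.2‖ with h | h <;> rw [h] <;>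
        nlinarith [sq_nonneg ‖p.1‖, sq_nonneg ‖p.2‖]
    calc _ ≤ C * (1 + 2 * ‖p‖) * (2 * ‖p‖) := by
          refine ContinuousLinearMap.le_of_opNorm_le_of_le _ ((hd _).trans ?_) ?_
          · gcongr
          · rwa [norm_rotationGenerator]
      _ = C * (2 * ‖p‖ + 4 * ‖p‖ ^ 2) := by ring
      _ ≤ _ := by rw [pow_one, pow_one]; gcongr) 0
  have h0 (p : EuclideanSpace ℝ (Fin n) × EuclideanSpace ℝ (Fin n)) :
      ContinuousLinearMap.rotation 0 p = p := by
    simp [ContinuousLinearMap.rotation_apply]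
  have hval : ∫ p, u p.1 * fderiv ℝ f (ContinuousLinearMap.rotation 0 p)
        (rotationGenerator (ContinuousLinearMap.rotation 0 p))
        ∂((gaussianMeasure n).prod (gaussianMeasure n)) =
      √(2 / π) * t * ∫ x, u x * gdiv n φ x ∂gaussianMeasure n := by
    simp_rw [h0] at hint ⊢
    rw [integral_mul_fderiv_rotationGenerator hf hb hd hint, funext hfield]
    simp_rw [gdiv_const_smul (hφ.1.differentiable (by simp)), mul_left_comm (u _),
      integral_const_mul]
  rw [hval] at hderiv
  have hθ : Tendsto (fun k : ℕ ↦ 1 / ((k : ℝ) + 1)) atTop (nhdsWithin 0 (Set.Ioi 0)) :=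
    tendsto_nhdsWithin_iff.mpr ⟨tendsto_one_div_add_atTop_nhds_zero_nat,
      .of_forall fun k ↦ Set.mem_Ioi.mpr Nat.one_div_pos_of_nat⟩
  have hlim := ENNReal.tendsto_ofReal (hderiv.tendsto_slope_zero_right.comp hθ)
  rw [← hlim.liminf_eq]
  refine liminf_le_liminf (.of_forall fun k ↦ ?_)
  have hk : (0 : ℝ) ≤ k + 1 := by positivity
  simp only [Function.comp_apply, zero_add, smul_eq_mul, one_div, inv_inv]
  rw [ENNReal.ofReal_mul hk]
  gcongr
  exact ofReal_integral_mul_rotation_sub_le hu hf.continuous hb _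

/-- The Gaussian total variation of a bounded function is controlled by its increments along
rotations of small angle. -/
theorem totVar_le_liminf (hu : Integrable u (gaussianMeasure n)) (hu1 : ∀ x, |u x| ≤ 1) :
    ENNReal.ofReal √(2 / π) * totVar n u ≤
      liminf (fun k : ℕ ↦ ENNReal.ofReal (k + 1) * rotationIncrement n u (1 / (k + 1))) atTop := by
  simp only [totVar, ENNReal.mul_iSup]
  refine iSup₂_le fun φ hφ ↦ ?_
  rw [← ENNReal.ofReal_mul (Real.sqrt_nonneg _)]
  have hlim : Tendsto (fun t : ℝ ↦ √(2 / π) * t * ∫ x, u x * gdiv n φ x ∂gaussianMeasure n)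
      (nhdsWithin 1 (Set.Iio 1))
      (nhds (√(2 / π) * 1 * ∫ x, u x * gdiv n φ x ∂gaussianMeasure n)) :=
    Tendsto.mono_left (Continuous.tendsto (by fun_prop) 1) nhdsWithin_le_nhds
  rw [mul_one] at hlim
  refine le_of_tendsto (ENNReal.tendsto_ofReal hlim) ?_
  filter_upwards [Ioo_mem_nhdsLT (zero_lt_one' ℝ)] with t ht
  exact ofReal_integral_mul_gdiv_le_liminf hu hu1 hφ ht.1 ht.2

end lowerBound

theorem ofReal_integral_le_lintegral_ofReal {X : Type*} [MeasurableSpace X] {μ : Measure X}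
    {f : X → ℝ} (hf : Integrable f μ) :
    ENNReal.ofReal (∫ x, f x ∂μ) ≤ ∫⁻ x, ENNReal.ofReal (f x) ∂μ := by
  rw [integral_eq_lintegral_pos_part_sub_lintegral_neg_part hf]
  exact (ENNReal.ofReal_le_ofReal (sub_le_self _ ENNReal.toReal_nonneg)).trans
    ENNReal.ofReal_toReal_le

section coarea

variable {n : ℕ} {u : EuclideanSpace ℝ (Fin n) → ℝ}

theorem totVar_congr_ae {v : EuclideanSpace ℝ (Fin n) → ℝ} (h : u =ᵐ[gaussianMeasure n] v) :
    totVar n u = totVar n v := by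
  unfold totVar
  refine iSup_congr fun φ ↦ iSup_congr fun _ ↦ congrArg _ (integral_congr_ae ?_)
  exact h.mono fun x hx ↦ by simp only [hx]

theorem gPerimeter_sublevel_congr_ae {v : EuclideanSpace ℝ (Fin n) → ℝ}
    (h : u =ᵐ[gaussianMeasure n] v) (r : ℝ) :
    gPerimeter n {x | u x < r} = gPerimeter n {x | v x < r} :=
  totVar_congr_ae (h.mono fun x hx ↦ by simp [Set.indicator_apply, hx])

theorem measurable_indicator_sublevel {X : Type*} [MeasurableSpace X] {w : X → ℝ}
    (hw : Measurable w) :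
    Measurable fun q : ℝ × X ↦ {x | w x < q.1}.indicator (fun _ ↦ (1 : ℝ)) q.2 := by
  have : (fun q : ℝ × X ↦ {x | w x < q.1}.indicator (fun _ ↦ (1 : ℝ)) q.2) =
      {q : ℝ × X | w q.2 < q.1}.indicator fun _ ↦ 1 := by
    ext q; simp [Set.indicator_apply]
  rw [this]
  exact measurable_const.indicator (measurableSet_lt (hw.comp measurable_snd) measurable_fst)

theorem lintegral_enorm_indicator_sublevel_sub {X : Type*} (w : X → ℝ) (x y : X) :
    ∫⁻ r : ℝ, ‖{x | w x < r}.indicator (fun _ ↦ (1 : ℝ)) x -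
      {x | w x < r}.indicator (fun _ ↦ (1 : ℝ)) y‖ₑ = ‖w x - w y‖ₑ := by
  have h (r : ℝ) : ‖{x | w x < r}.indicator (fun _ ↦ (1 : ℝ)) x -
      {x | w x < r}.indicator (fun _ ↦ (1 : ℝ)) y‖ₑ = (Set.uIoc (w y) (w x)).indicator 1 r := by
    by_cases h1 : w x < r <;> by_cases h2 : w y < r <;>
      simp [Set.mem_uIoc, h1, h2, not_le.mpr, not_lt.mp]
  simp_rw [h]
  rw [lintegral_indicator_one measurableSet_uIoc, Real.volume_uIoc, Real.enorm_eq_ofReal_abs]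

theorem measurable_rotationIncrement_integrand (hu : Measurable u) (θ : ℝ) :
    Measurable fun q : ℝ × EuclideanSpace ℝ (Fin n) × EuclideanSpace ℝ (Fin n) ↦
      ‖{x | u x < q.1}.indicator (fun _ ↦ (1 : ℝ)) (ContinuousLinearMap.rotation (-θ) q.2).1 -
        {x | u x < q.1}.indicator (fun _ ↦ (1 : ℝ)) q.2.1‖ₑ := by
  have hm := measurable_indicator_sublevel hu
  have hr : Measurable fun q : ℝ × EuclideanSpace ℝ (Fin n) × EuclideanSpace ℝ (Fin n) ↦
      (q.1, (ContinuousLinearMap.rotation (-θ) q.2).1) :=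
    measurable_fst.prodMk (measurable_fst.comp
      ((ContinuousLinearMap.rotation (-θ)).continuous.measurable.comp measurable_snd))
  have hs : Measurable fun q : ℝ × EuclideanSpace ℝ (Fin n) × EuclideanSpace ℝ (Fin n) ↦
      (q.1, q.2.1) := by fun_prop
  exact ((hm.comp hr).sub (hm.comp hs)).enorm

theorem measurable_rotationIncrement_sublevel (hu : Measurable u) (θ : ℝ) :
    Measurable fun r : ℝ ↦ rotationIncrement n ({x | u x < r}.indicator fun _ ↦ 1) θ :=
  (measurable_rotationIncrement_integrand hu θ).lintegral_prod_right'

theorem lintegral_rotationIncrement_sublevel (hu : Measurable u) (θ : ℝ) :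
    ∫⁻ r : ℝ, rotationIncrement n ({x | u x < r}.indicator fun _ ↦ 1) θ =
      rotationIncrement n u θ := by
  simp only [rotationIncrement]
  rw [lintegral_lintegral_swap (measurable_rotationIncrement_integrand hu θ).aemeasurable]
  simp_rw [lintegral_enorm_indicator_sublevel_sub]

theorem rotationIncrement_le (hu : Integrable u (gaussianMeasure n)) (hfin : totVar n u ≠ ⊤)
    {θ : ℝ} (hθ : 0 ≤ θ) :
    rotationIncrement n u θ ≤ ENNReal.ofReal √(2 / π) * totVar n u * ENNReal.ofReal θ := by
  have hu2 : Integrable (fun p : EuclideanSpace ℝ (Fin n) × EuclideanSpace ℝ (Fin n) ↦ u p.1)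
    ((gaussianMeasure n).prod (gaussianMeasure n)) := hu.comp_fst _
  have h := ofReal_integral_norm_eq_lintegral_enorm
    ((integrable_comp_rotation_fst hu (-θ)).sub hu2)
  have h2 := ENNReal.ofReal_le_ofReal (integral_abs_rotation_sub_le hu hfin hθ)
  rw [ENNReal.ofReal_mul (by positivity), ENNReal.ofReal_mul (by positivity),
    ENNReal.ofReal_toReal hfin] at h2
  exact h.symm.le.trans h2

theorem ofReal_mul_rotationIncrement_le (hu : Integrable u (gaussianMeasure n))
    (hfin : totVar n u ≠ ⊤) (k : ℕ) :
    ENNReal.ofReal (k + 1) * rotationIncrement n u (1 / (k + 1)) ≤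
      ENNReal.ofReal √(2 / π) * totVar n u := by
  have hk : (0 : ℝ) < k + 1 := by positivity
  calc _ ≤ ENNReal.ofReal (k + 1) *
        (ENNReal.ofReal √(2 / π) * totVar n u * ENNReal.ofReal (1 / (k + 1))) := by
        gcongr
        exact rotationIncrement_le hu hfin (by positivity)
    _ = ENNReal.ofReal √(2 / π) * totVar n u *
        (ENNReal.ofReal (k + 1) * ENNReal.ofReal (1 / (k + 1))) := by ring
    _ = _ := by
        rw [← ENNReal.ofReal_mul hk.le, mul_one_div_cancel hk.ne', ENNReal.ofReal_one, mul_one]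

theorem exists_measurable_ge_gPerimeter_sublevel (hu : Integrable u (gaussianMeasure n))
    (hum : Measurable u) (hfin : totVar n u ≠ ⊤) :
    ∃ L : ℝ → ℝ≥0∞, Measurable L ∧ (∀ r, gPerimeter n {x | u x < r} ≤ L r) ∧
      ∫⁻ r, L r ≤ totVar n u := by
  set c := ENNReal.ofReal √(2 / π) with hc
  have hc0 : c ≠ 0 := by
    rw [hc, ENNReal.ofReal_ne_zero_iff]; positivity
  have hct : c ≠ ⊤ := ENNReal.ofReal_ne_top
  have hmeas (k : ℕ) : Measurable fun r : ℝ ↦ ENNReal.ofReal (k + 1) *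
      rotationIncrement n ({x | u x < r}.indicator fun _ ↦ 1) (1 / (k + 1)) :=
    (measurable_rotationIncrement_sublevel hum _).const_mul _
  have hliminf := Measurable.liminf hmeas
  refine ⟨fun r ↦ c⁻¹ * liminf (fun k : ℕ ↦ ENNReal.ofReal (k + 1) *
      rotationIncrement n ({x | u x < r}.indicator fun _ ↦ 1) (1 / (k + 1))) atTop,
    hliminf.const_mul _, fun r ↦ ?_, ?_⟩
  · have hset : MeasurableSet {x | u x < r} := measurableSet_lt hum measurable_const
    have h := totVar_le_liminf (n := n) (u := {x | u x < r}.indicator fun _ ↦ 1)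
      ((integrable_const 1).indicator hset) fun x ↦ by
        by_cases hx : u x < r <;> simp [hx]
    rw [← ENNReal.mul_le_mul_iff_right hc0 hct, ← mul_assoc, ENNReal.mul_inv_cancel hc0 hct,
      one_mul]
    exact h
  · rw [lintegral_const_mul _ hliminf]
    calc _ ≤ c⁻¹ * (c * totVar n u) := by
          gcongr
          refine (lintegral_liminf_le hmeas).trans ?_
          refine liminf_le_of_frequently_le' (.of_forall fun k ↦ ?_)
          rw [lintegral_const_mul _ (measurable_rotationIncrement_sublevel hum _),
            lintegral_rotationIncrement_sublevel hum]
          exact ofReal_mul_rotationIncrement_le hu hfin k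
      _ = totVar n u := by rw [← mul_assoc, ENNReal.inv_mul_cancel hc0 hct, one_mul]

variable {φ : EuclideanSpace ℝ (Fin n) → EuclideanSpace ℝ (Fin n)}

theorem Admissible.continuous_gdiv (hφ : Admissible n φ) : Continuous (gdiv n φ) := by
  have h := hφ.1.continuous_fderiv (by simp)
  have h' := hφ.1.continuous
  unfold gdiv
  fun_prop

theorem Admissible.integrable_fderiv_apply (hφ : Admissible n φ) (i : Fin n) :
    Integrable (fun x ↦ fderiv ℝ φ x (EuclideanSpace.single i 1) i) (gaussianMeasure n) := by
  obtain ⟨M, hM⟩ := hφ.2.1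
  have h := hφ.1.continuous_fderiv (by simp)
  refine .of_bound (Continuous.aestronglyMeasurable (by fun_prop)) M (.of_forall fun x ↦ ?_)
  refine (PiLp.norm_apply_le _ i).trans ((ContinuousLinearMap.le_of_opNorm_le _ (hM x) _).trans ?_)
  simp

theorem Admissible.integrable_apply_mul_inner (hφ : Admissible n φ) (i : Fin n) :
    Integrable (fun x ↦ φ x i * ⟪EuclideanSpace.single i 1, x⟫) (gaussianMeasure n) := by
  have h' := hφ.1.continuous
  refine (integrable_norm_pow_gaussianMeasure n 1).mono' (by fun_prop) (.of_forall fun x ↦ ?_)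
  rw [norm_mul, pow_one]
  calc ‖φ x i‖ * ‖⟪EuclideanSpace.single i 1, x⟫‖
      ≤ 1 * (‖(EuclideanSpace.single i 1 : EuclideanSpace ℝ (Fin n))‖ * ‖x‖) := by
        gcongr
        · exact (PiLp.norm_apply_le _ i).trans (hφ.2.2 x)
        · exact norm_inner_le_norm _ _
    _ = ‖x‖ := by simp

theorem gdiv_eq_sum (x : EuclideanSpace ℝ (Fin n)) : gdiv n φ x =
    ∑ i, (fderiv ℝ φ x (EuclideanSpace.single i 1) i - φ x i * ⟪EuclideanSpace.single i 1, x⟫) := by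
  rw [gdiv, Finset.sum_sub_distrib, PiLp.inner_apply]
  simp [EuclideanSpace.inner_single_left]

theorem Admissible.integrable_gdiv (hφ : Admissible n φ) :
    Integrable (gdiv n φ) (gaussianMeasure n) := by
  rw [funext (gdiv_eq_sum (φ := φ))]
  exact integrable_finsetSum _ fun i _ ↦
    (hφ.integrable_fderiv_apply i).sub (hφ.integrable_apply_mul_inner i)

theorem Admissible.integral_gdiv (hφ : Admissible n φ) :
    ∫ x, gdiv n φ x ∂gaussianMeasure n = 0 := by
  simp_rw [gdiv_eq_sum]
  refine (integral_finsetSum _ fun i _ ↦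
    (hφ.integrable_fderiv_apply i).sub (hφ.integrable_apply_mul_inner i)).trans ?_
  refine Finset.sum_eq_zero fun i _ ↦ ?_
  refine (integral_sub (hφ.integrable_fderiv_apply i) (hφ.integrable_apply_mul_inner i)).trans ?_
  rw [sub_eq_zero]
  have hd (x) : HasFDerivAt (fun x ↦ φ x i) ((EuclideanSpace.proj i).comp (fderiv ℝ φ x)) x :=
    (EuclideanSpace.proj (𝕜 := ℝ) i).hasFDerivAt.comp x
      (hφ.1.differentiable (by simp) x).hasFDerivAt
  have he (x) : fderiv ℝ (fun x ↦ φ x i) x (EuclideanSpace.single i 1) =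
      fderiv ℝ φ x (EuclideanSpace.single i 1) i := by
    rw [(hd x).fderiv]; simp
  have h := integral_fderiv_gaussianMeasure (F := fun x ↦ φ x i) (EuclideanSpace.single i 1)
    (fun x ↦ (hd x).differentiableAt)
  simp_rw [he] at h
  refine h (hφ.integrable_fderiv_apply i) (hφ.integrable_apply_mul_inner i) ?_
  have h' := hφ.1.continuous
  exact .of_bound (by fun_prop) 1
    (.of_forall fun x ↦ (PiLp.norm_apply_le _ i).trans (hφ.2.2 x))

theorem Admissible.neg (hφ : Admissible n φ) : Admissible n fun x ↦ (-1 : ℝ) • φ x := by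
  obtain ⟨h1, ⟨M, hM⟩, h2⟩ := hφ
  refine ⟨h1.const_smul _, ⟨M, fun x ↦ ?_⟩, fun x ↦ by simpa using h2 x⟩
  rw [fderiv_fun_const_smul (h1.differentiable (by simp) x)]
  simpa using hM x

/-- The kernel `1_{0 < r} - 1_{u(x) < r}` of the layer-cake decomposition of `u`. -/
noncomputable def layerKernel {X : Type*} (w : X → ℝ) (r : ℝ) (x : X) : ℝ :=
  (Set.Ioi 0).indicator (fun _ ↦ 1) r - {x | w x < r}.indicator (fun _ ↦ 1) x

theorem layerKernel_eq {X : Type*} (w : X → ℝ) (r : ℝ) (x : X) :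
    layerKernel w r x = (Set.Ioc 0 (w x)).indicator (fun _ ↦ 1) r -
      (Set.Ioc (w x) 0).indicator (fun _ ↦ 1) r := by
  rw [layerKernel]
  by_cases h1 : w x < r <;> by_cases h2 : 0 < r <;>
    simp [h1, h2, not_le.mpr, not_lt.mp]

theorem integral_layerKernel {X : Type*} (w : X → ℝ) (x : X) : ∫ r, layerKernel w r x = w x := by
  have hi (a b : ℝ) : Integrable ((Set.Ioc a b).indicator fun _ ↦ (1 : ℝ)) :=
    (integrable_indicator_iff measurableSet_Ioc).mpr (by simp)
  simp_rw [layerKernel_eq]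
  rw [integral_sub (hi _ _) (hi _ _), integral_indicator measurableSet_Ioc,
    integral_indicator measurableSet_Ioc, ← intervalIntegral]
  simp

theorem lintegral_enorm_layerKernel {X : Type*} (w : X → ℝ) (x : X) :
    ∫⁻ r, ‖layerKernel w r x‖ₑ = ‖w x‖ₑ := by
  have h (r : ℝ) : ‖layerKernel w r x‖ₑ = (Set.uIoc 0 (w x)).indicator 1 r := by
    rw [layerKernel]
    by_cases h1 : w x < r <;> by_cases h2 : 0 < r <;>
      simp [Set.mem_uIoc, h1, h2, not_le.mpr, not_lt.mp]
  simp_rw [h]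
  rw [lintegral_indicator_one measurableSet_uIoc, Real.volume_uIoc, Real.enorm_eq_ofReal_abs,
    sub_zero]

theorem integrable_layerKernel_mul (hu : Measurable u) {g : EuclideanSpace ℝ (Fin n) → ℝ}
    (hg : Measurable g) (hint : Integrable (fun x ↦ u x * g x) (gaussianMeasure n)) :
    Integrable (fun q : ℝ × EuclideanSpace ℝ (Fin n) ↦ layerKernel u q.1 q.2 * g q.2)
      (volume.prod (gaussianMeasure n)) := by
  have hm : Measurable fun q : ℝ × EuclideanSpace ℝ (Fin n) ↦ layerKernel u q.1 q.2 * g q.2 :=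
    (((measurable_const.indicator measurableSet_Ioi).comp measurable_fst).sub
      (measurable_indicator_sublevel hu)).mul (hg.comp measurable_snd)
  refine ⟨hm.aestronglyMeasurable, ?_⟩
  rw [HasFiniteIntegral, lintegral_prod_symm' _ hm.enorm]
  refine lt_of_eq_of_lt (lintegral_congr fun x ↦ ?_) hint.2
  simp_rw [enorm_mul]
  rw [lintegral_mul_const' _ _ (by simp), lintegral_enorm_layerKernel]

theorem integral_layerKernel_mul_gdiv (hu : Measurable u) (hφ : Admissible n φ) (r : ℝ) :
    ∫ x, layerKernel u r x * gdiv n φ x ∂gaussianMeasure n =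
      ∫ x, {x | u x < r}.indicator (fun _ ↦ 1) x * gdiv n (fun x ↦ (-1 : ℝ) • φ x) x
        ∂gaussianMeasure n := by
  have hset : MeasurableSet {x | u x < r} := measurableSet_lt hu measurable_const
  have hi : Integrable (fun x ↦ {x | u x < r}.indicator (fun _ ↦ (1 : ℝ)) x * gdiv n φ x)
      (gaussianMeasure n) := by
    simpa [← Set.indicator_mul_left] using hφ.integrable_gdiv.indicator hset
  simp_rw [layerKernel, sub_mul]
  rw [integral_sub (hφ.integrable_gdiv.const_mul _) hi, integral_const_mul, hφ.integral_gdiv]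
  simp_rw [gdiv_const_smul (hφ.1.differentiable (by simp))]
  rw [mul_zero, zero_sub, ← integral_neg]
  congr with x
  ring

theorem totVar_le_lintegral_gPerimeter_sublevel (hum : Measurable u) :
    totVar n u ≤ ∫⁻ r : ℝ, gPerimeter n {x | u x < r} := by
  refine iSup₂_le fun φ hφ ↦ ?_
  by_cases hint : Integrable (fun x ↦ u x * gdiv n φ x) (gaussianMeasure n)
  · have hk := integrable_layerKernel_mul hum hφ.continuous_gdiv.measurable hint
    have h : ∫ x, u x * gdiv n φ x ∂gaussianMeasure n =
        ∫ r, ∫ x, layerKernel u r x * gdiv n φ x ∂gaussianMeasure n := by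
      rw [integral_integral_swap hk]
      simp_rw [integral_mul_const, integral_layerKernel]
    rw [h]
    refine (ofReal_integral_le_lintegral_ofReal hk.integral_prod_left).trans (lintegral_mono fun r ↦ ?_)
    rw [integral_layerKernel_mul_gdiv hum hφ]
    exact le_iSup₂_of_le (fun x ↦ (-1 : ℝ) • φ x) hφ.neg le_rfl
  · rw [integral_undef hint]
    simp

end coarea

/-- Coarea formula: if `u ∈ L¹(γ_n)` has finite Gaussian total
variation, then for almost every `r ∈ ℝ` the sublevel set `{u < r}` has finite Gaussian
perimeter, and `V_γ(u) = ∫_ℝ P_γ({u < r}) dr`. -/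
theorem gaussian_coarea (n : ℕ) (u : EuclideanSpace ℝ (Fin n) → ℝ)
    (hu : Integrable u (gaussianMeasure n)) (hfin : totVar n u ≠ ⊤) :
    (∀ᵐ r ∂(volume : Measure ℝ), gPerimeter n {x | u x < r} ≠ ⊤) ∧
    totVar n u = ∫⁻ r : ℝ, gPerimeter n {x | u x < r} := by
  have hae := hu.1.ae_eq_mk
  have hm := hu.1.stronglyMeasurable_mk.measurable
  simp_rw [gPerimeter_sublevel_congr_ae hae]
  rw [totVar_congr_ae hae] at hfin ⊢
  obtain ⟨L, hL, hle, hint⟩ :=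
    exists_measurable_ge_gPerimeter_sublevel (hu.congr hae) hm hfin
  refine ⟨?_, (totVar_le_lintegral_gPerimeter_sublevel hm).antisymm
    ((lintegral_mono hle).trans hint)⟩
  filter_upwards [ae_lt_top hL (ne_top_of_le_ne_top hfin hint)] with r hr
  exact ne_top_of_le_ne_top hr.ne (hle r)
end

section
/- For each integer k ≥ 1 let r_k > 0 be the unique positive solution of √(2/π) · e^{−r_k²/2}/r_k = 1/((k+1)(log(k+1))^{3/2}). For each n, let P_{γ_n} denote the Gaussian perimeter in ℝ^n. Then the Gaussian perimeters of the boxes C_n = ∏_{j=1}^n [−r_j, r_j] ⊆ ℝ^n diverge: lim_{n→∞} P_{γ_n}(C_n) = +∞. -/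
open MeasureTheory Real Filter
open scoped RealInnerProductSpace ENNReal

/-- The density of the standard Gaussian measure on the real line. -/
noncomputable def stdDensity (t : ℝ) : ℝ := (√(2 * π))⁻¹ * Real.exp (-t ^ 2 / 2)

lemma stdDensity_pos (t : ℝ) : 0 < stdDensity t := by unfold stdDensity; positivity

lemma stdDensity_neg (t : ℝ) : stdDensity (-t) = stdDensity t := by simp [stdDensity]

lemma stdDensity_eq_gaussianPDFReal : stdDensity = ProbabilityTheory.gaussianPDFReal 0 1 := by
  ext t; simp [stdDensity, ProbabilityTheory.gaussianPDFReal]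

lemma integrable_stdDensity : Integrable stdDensity :=
  stdDensity_eq_gaussianPDFReal ▸ ProbabilityTheory.integrable_gaussianPDFReal 0 1

lemma integral_stdDensity : ∫ t, stdDensity t = 1 := by
  rw [stdDensity_eq_gaussianPDFReal]
  exact ProbabilityTheory.integral_gaussianPDFReal_eq_one 0 one_ne_zero

lemma continuous_stdDensity : Continuous stdDensity := by unfold stdDensity; fun_prop

lemma hasDerivAt_stdDensity (t : ℝ) : HasDerivAt stdDensity (-(t * stdDensity t)) t := by
  have h : HasDerivAt (fun t : ℝ => -t ^ 2 / 2) (-t) t := by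
    convert! ((hasDerivAt_pow 2 t).neg.div_const 2) using 1
    norm_num; ring
  convert! h.exp.const_mul (√(2 * π))⁻¹ using 1
  simp only [stdDensity]; ring

lemma tendsto_stdDensity_atTop : Tendsto stdDensity atTop (nhds 0) := by
  have h : Tendsto (fun t : ℝ => t ^ 2 / 2) atTop atTop :=
    (tendsto_pow_atTop two_ne_zero).atTop_div_const two_pos
  have := (Real.tendsto_exp_neg_atTop_nhds_zero.comp h).const_mul (√(2 * π))⁻¹
  rw [mul_zero] at this
  refine this.congr fun t => ?_
  simp [stdDensity, neg_div]

/-- The Gaussian tail bound. -/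
lemma integral_Ioi_stdDensity_le {s : ℝ} (hs : 0 < s) :
    ∫ t in Set.Ioi s, stdDensity t ≤ stdDensity s / s := by
  have hd : ∀ x ∈ Set.Ici s,
      HasDerivAt (fun t => -stdDensity t / s) (x * stdDensity x / s) x := fun x _ => by
    simpa using (hasDerivAt_stdDensity x).neg.div_const s
  have hpos : ∀ x ∈ Set.Ioi s, 0 ≤ x * stdDensity x / s := fun x hx =>
    div_nonneg (mul_nonneg (hs.le.trans (le_of_lt hx)) (stdDensity_pos x).le) hs.le
  have hlim : Tendsto (fun t => -stdDensity t / s) atTop (nhds 0) := by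
    simpa using tendsto_stdDensity_atTop.neg.div_const s
  have hint := integrableOn_Ioi_deriv_of_nonneg' hd hpos hlim
  have hval := integral_Ioi_of_hasDerivAt_of_nonneg' hd hpos hlim
  calc ∫ t in Set.Ioi s, stdDensity t ≤ ∫ t in Set.Ioi s, t * stdDensity t / s := by
        refine setIntegral_mono_on integrable_stdDensity.integrableOn hint measurableSet_Ioi
          fun x hx => ?_
        rw [le_div_iff₀ hs, mul_comm]
        exact mul_le_mul_of_nonneg_right (le_of_lt hx) (stdDensity_pos x).le
    _ = stdDensity s / s := by rw [hval]; ring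

lemma one_sub_le_integral_Icc_stdDensity {s : ℝ} (hs : 0 < s) :
    1 - 2 * (stdDensity s / s) ≤ ∫ t in Set.Icc (-s) s, stdDensity t := by
  have h1 : ∫ t in Set.Iic (-s), stdDensity t = ∫ t in Set.Ioi s, stdDensity t := by
    have := integral_comp_neg_Iic (-s) stdDensity
    simpa [stdDensity_neg] using this
  have h2 : ∫ t in Set.Iic s, stdDensity t
      = (∫ t in Set.Iic (-s), stdDensity t) + ∫ t in Set.Ioc (-s) s, stdDensity t := by
    rw [← Set.Iic_union_Ioc_eq_Iic (by linarith : -s ≤ s)]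
    exact setIntegral_union (by
      rw [Set.disjoint_left]; intro x hx hx'; exact absurd hx'.1 (not_lt.2 hx))
      measurableSet_Ioc integrable_stdDensity.integrableOn integrable_stdDensity.integrableOn
  have h3 := intervalIntegral.integral_Iic_add_Ioi (b := s) (f := stdDensity) (μ := volume)
    integrable_stdDensity.integrableOn integrable_stdDensity.integrableOn
  rw [integral_stdDensity] at h3
  rw [integral_Icc_eq_integral_Ioc]
  linarith [integral_Ioi_stdDensity_le hs]

/-- A profile for the facet `t = ±r` of a slab together with a disjointly supported cutoff. -/
lemma exists_facet_profile {r : ℝ} (hr : 0 < r) :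
    ∃ f h : ℝ → ℝ, ContDiff ℝ 1 f ∧ ContDiff ℝ 1 h ∧ HasCompactSupport f ∧ HasCompactSupport h ∧
      (∀ t, |f t| ≤ 1) ∧ (∀ t, 0 ≤ h t) ∧ (∀ t, h t ≤ 1) ∧ (∀ t, f t = 0 ∨ h t = 0) ∧
      (∫ t in Set.Icc (-r) r, (deriv f t - t * f t) * stdDensity t) = 2 * stdDensity r ∧
      0 < (∫ t in Set.Icc (-r) r, h t * stdDensity t) ∧
      (∫ t in Set.Icc (-r) r, h t * stdDensity t) ≤ 1 ∧
      1 - 4 * (stdDensity r / r) ≤ ∫ t in Set.Icc (-r) r, h t * stdDensity t := by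
  obtain ⟨s, hs0, hsr, hs⟩ : ∃ s, 0 < s ∧ s < r ∧ stdDensity s / s < 2 * (stdDensity r / r) := by
    have hc : ContinuousAt (fun s => stdDensity s / s) r :=
      continuous_stdDensity.continuousAt.div continuousAt_id hr.ne'
    have hlt : stdDensity r / r < 2 * (stdDensity r / r) := by
      have := div_pos (stdDensity_pos r) hr; linarith
    have h1 := (hc.eventually_lt continuousAt_const hlt).filter_mono
      (nhdsWithin_le_nhds (s := Set.Iio r))
    have h2 : ∀ᶠ s in nhdsWithin r (Set.Iio r), s ∈ Set.Ioo 0 r := Ioo_mem_nhdsLT hr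
    obtain ⟨s, h, h'⟩ := (h1.and h2).exists
    exact ⟨s, h'.1, h'.2, h⟩
  let H : ContDiffBump (0 : ℝ) := ⟨s, (s + r) / 2, hs0, by linarith⟩
  let A : ContDiffBump (r : ℝ) := ⟨(r - s) / 4, (r - s) / 2, by linarith, by linarith⟩
  let B : ContDiffBump (-r : ℝ) := ⟨(r - s) / 4, (r - s) / 2, by linarith, by linarith⟩
  have hA0 : ∀ t, (r - s) / 2 ≤ |t - r| → A t = 0 := fun t ht => A.zero_of_le_dist ht
  have hB0 : ∀ t, (r - s) / 2 ≤ |t + r| → B t = 0 := fun t ht =>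
    B.zero_of_le_dist (by simpa [Real.dist_eq] using ht)
  have hH0 : ∀ t, (s + r) / 2 ≤ |t| → H t = 0 := fun t ht =>
    H.zero_of_le_dist (by simpa [Real.dist_eq] using ht)
  have hH1 : ∀ t ∈ Set.Icc (-s) s, H t = 1 := fun t ht =>
    H.one_of_mem_closedBall (by simpa [Real.dist_eq, abs_le] using ht)
  have hf : ContDiff ℝ 1 (fun t => A t - B t) := A.contDiff.sub B.contDiff
  have hAB : ∀ t, A t = 0 ∨ B t = 0 := by
    intro t
    by_cases h : (r - s) / 2 ≤ |t - r|
    · exact Or.inl (hA0 t h)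
    · right; apply hB0
      rw [not_le, abs_lt] at h
      exact le_trans (by linarith) (le_abs_self _)
  have hint : Integrable fun t => H t * stdDensity t :=
    integrable_stdDensity.bdd_mul (c := 1) H.continuous.aestronglyMeasurable
      (ae_of_all _ fun t => by
        rw [Real.norm_eq_abs, abs_of_nonneg H.nonneg]; exact H.le_one)
  have hlow : ∫ t in Set.Icc (-s) s, stdDensity t
      ≤ ∫ t in Set.Icc (-r) r, H t * stdDensity t := by
    calc ∫ t in Set.Icc (-s) s, stdDensity t = ∫ t in Set.Icc (-s) s, H t * stdDensity t :=
          setIntegral_congr_fun measurableSet_Icc fun t ht => by simp [hH1 t ht]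
      _ ≤ _ := setIntegral_mono_set hint.integrableOn
          (ae_of_all _ fun t => mul_nonneg H.nonneg (stdDensity_pos t).le)
          (Set.Icc_subset_Icc (by linarith) hsr.le).eventuallyLE
  refine ⟨fun t => A t - B t, H, hf, H.contDiff, A.hasCompactSupport.sub B.hasCompactSupport,
    H.hasCompactSupport, fun t => ?_, fun t => H.nonneg, fun t => H.le_one, fun t => ?_, ?_, ?_,
    ?_, ?_⟩
  · have := A.nonneg (x := t); have := A.le_one (x := t)
    have := B.nonneg (x := t); have := B.le_one (x := t)
    rw [abs_le]; constructor <;> linarith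
  · by_cases h : (s + r) / 2 ≤ |t|
    · exact Or.inr (hH0 t h)
    · left
      rw [not_le, abs_lt] at h
      change A t - B t = 0
      rw [hA0, hB0, sub_zero]
      · exact le_trans (by linarith) (le_abs_self _)
      · exact le_trans (by linarith) (neg_le_abs _)
  · have hd : ∀ t, HasDerivAt (fun t => (A t - B t) * stdDensity t)
        ((deriv (fun t => A t - B t) t - t * (A t - B t)) * stdDensity t) t := fun t => by
      convert! ((hf.differentiable one_ne_zero t).hasDerivAt.mul (hasDerivAt_stdDensity t)) using 1
      ring
    have hcont : Continuous fun t =>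
        (deriv (fun t => A t - B t) t - t * (A t - B t)) * stdDensity t :=
      ((hf.continuous_deriv le_rfl).sub (continuous_id.mul hf.continuous)).mul
        continuous_stdDensity
    rw [integral_Icc_eq_integral_Ioc, ← intervalIntegral.integral_of_le (by linarith),
      intervalIntegral.integral_eq_sub_of_hasDerivAt (fun t _ => hd t)
        (hcont.intervalIntegrable _ _)]
    have e1 : A r = 1 := A.one_of_mem_closedBall (Metric.mem_closedBall_self A.rIn_pos.le)
    have e2 : B (-r) = 1 := B.one_of_mem_closedBall (Metric.mem_closedBall_self B.rIn_pos.le)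
    have e3 : B r = 0 := (hAB r).resolve_left (by simp [e1])
    have e4 : A (-r) = 0 := (hAB (-r)).resolve_right (by simp [e2])
    rw [e1, e2, e3, e4, stdDensity_neg]; ring
  · refine lt_of_lt_of_le ?_ hlow
    rw [integral_Icc_eq_integral_Ioc, ← intervalIntegral.integral_of_le (by linarith)]
    exact intervalIntegral.intervalIntegral_pos_of_pos
      (continuous_stdDensity.intervalIntegrable _ _) stdDensity_pos (by linarith)
  · calc ∫ t in Set.Icc (-r) r, H t * stdDensity t ≤ ∫ t, H t * stdDensity t :=
          setIntegral_le_integral hint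
            (ae_of_all _ fun t => mul_nonneg H.nonneg (stdDensity_pos t).le)
      _ ≤ ∫ t, stdDensity t := integral_mono hint integrable_stdDensity fun t =>
          mul_le_of_le_one_left (stdDensity_pos t).le H.le_one
      _ = 1 := integral_stdDensity
  · linarith [one_sub_le_integral_Icc_stdDensity hs0]

/-- The vector field with `j`-th component `f j (x j) * ∏ i ≠ j, h i (x i)`. -/
noncomputable def facetField {n : ℕ} (f h : Fin n → ℝ → ℝ) (x : EuclideanSpace ℝ (Fin n)) :
    EuclideanSpace ℝ (Fin n) :=
  WithLp.toLp 2 fun j => f j (x j) * ∏ i ∈ Finset.univ.erase j, h i (x i)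

section facetField

variable {n : ℕ} {f h : Fin n → ℝ → ℝ}

lemma contDiff_facetField (hf : ∀ j, ContDiff ℝ 1 (f j)) (hh : ∀ j, ContDiff ℝ 1 (h j)) :
    ContDiff ℝ 1 (facetField f h) := by
  rw [contDiff_euclidean]
  intro j
  have hc : ∀ i : Fin n, ContDiff ℝ 1 fun x : EuclideanSpace ℝ (Fin n) => x i := fun i => by
    fun_prop
  exact ((hf j).comp (hc j)).mul (contDiff_prod fun i _ => (hh i).comp (hc i))

lemma hasCompactSupport_facetField (hf : ∀ j, HasCompactSupport (f j))
    (hh : ∀ j, HasCompactSupport (h j)) : HasCompactSupport (facetField f h) := by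
  let K : Set (Fin n → ℝ) := Set.univ.pi fun i => tsupport (f i) ∪ tsupport (h i)
  have hK : IsCompact K := isCompact_univ_pi fun i => (hf i).union (hh i)
  refine HasCompactSupport.intro
    ((EuclideanSpace.equiv (Fin n) ℝ).toHomeomorph.isCompact_preimage.2 hK) fun x hx => ?_
  have : ∃ i, x i ∉ tsupport (f i) ∪ tsupport (h i) := by
    by_contra! hcon
    exact hx fun i _ => hcon i
  obtain ⟨i, hi⟩ := this
  rw [Set.mem_union, not_or] at hi
  have h1 := image_eq_zero_of_notMem_tsupport hi.1
  have h2 := image_eq_zero_of_notMem_tsupport hi.2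
  ext j
  change f j (x j) * ∏ i ∈ Finset.univ.erase j, h i (x i) = 0
  by_cases hij : i = j
  · subst hij; rw [h1, zero_mul]
  · rw [Finset.prod_eq_zero (Finset.mem_erase.2 ⟨hij, Finset.mem_univ i⟩) h2, mul_zero]

lemma norm_facetField_le_one (hf1 : ∀ j t, |f j t| ≤ 1) (hh0 : ∀ j t, 0 ≤ h j t)
    (hh1 : ∀ j t, h j t ≤ 1) (hfh : ∀ j t, f j t = 0 ∨ h j t = 0)
    (x : EuclideanSpace ℝ (Fin n)) : ‖facetField f h x‖ ≤ 1 := by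
  by_cases hx : ∃ j, f j (x j) ≠ 0
  · obtain ⟨j, hj⟩ := hx
    have hhj : h j (x j) = 0 := (hfh j (x j)).resolve_left hj
    have : facetField f h x = EuclideanSpace.single j (facetField f h x j) := by
      ext i
      by_cases hij : i = j
      · subst hij; simp
      · rw [PiLp.single_apply, if_neg hij]
        change f i (x i) * ∏ k ∈ Finset.univ.erase i, h k (x k) = 0
        rw [Finset.prod_eq_zero (Finset.mem_erase.2 ⟨Ne.symm hij, Finset.mem_univ j⟩) hhj,
          mul_zero]
    rw [this, PiLp.norm_single, Real.norm_eq_abs]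
    change |f j (x j) * ∏ k ∈ Finset.univ.erase j, h k (x k)| ≤ 1
    rw [abs_mul, abs_of_nonneg (Finset.prod_nonneg fun k _ => hh0 k _)]
    exact mul_le_one₀ (hf1 _ _) (Finset.prod_nonneg fun k _ => hh0 k _)
      (Finset.prod_le_one (fun k _ => hh0 k _) fun k _ => hh1 k _)
  · push Not at hx
    have : facetField f h x = 0 := by ext j; simp [facetField, hx]
    simp [this]

lemma admissible_facetField (hf : ∀ j, ContDiff ℝ 1 (f j)) (hh : ∀ j, ContDiff ℝ 1 (h j))
    (hfc : ∀ j, HasCompactSupport (f j)) (hhc : ∀ j, HasCompactSupport (h j))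
    (hf1 : ∀ j t, |f j t| ≤ 1) (hh0 : ∀ j t, 0 ≤ h j t)
    (hh1 : ∀ j t, h j t ≤ 1) (hfh : ∀ j t, f j t = 0 ∨ h j t = 0) :
    Admissible n (facetField f h) :=
  have hC := contDiff_facetField hf hh
  ⟨hC, ((hasCompactSupport_facetField hfc hhc).fderiv ℝ).exists_bound_of_continuous
    (hC.continuous_fderiv one_ne_zero), norm_facetField_le_one hf1 hh0 hh1 hfh⟩

lemma fderiv_facetField_single (hf : ∀ j, ContDiff ℝ 1 (f j)) (hh : ∀ j, ContDiff ℝ 1 (h j))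
    (x : EuclideanSpace ℝ (Fin n)) (j : Fin n) :
    fderiv ℝ (facetField f h) x (EuclideanSpace.single j 1) j
      = deriv (f j) (x j) * ∏ i ∈ Finset.univ.erase j, h i (x i) := by
  have hφ : HasFDerivAt (facetField f h) (fderiv ℝ (facetField f h) x) x :=
    ((contDiff_facetField hf hh).differentiable one_ne_zero x).hasFDerivAt
  have h1 : HasDerivAt (fun t : ℝ => facetField f h (x + t • EuclideanSpace.single j 1) j)
      (fderiv ℝ (facetField f h) x (EuclideanSpace.single j 1) j) 0 :=
    ((PiLp.proj 2 (fun _ : Fin n => ℝ) j : EuclideanSpace ℝ (Fin n) →L[ℝ] ℝ).hasFDerivAt.comp x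
      hφ).hasLineDerivAt (EuclideanSpace.single j 1)
  have h2 : (fun t : ℝ => facetField f h (x + t • EuclideanSpace.single j 1) j)
      = fun t => f j (x j + t) * ∏ i ∈ Finset.univ.erase j, h i (x i) := by
    ext t
    change f j ((x + t • EuclideanSpace.single j (1 : ℝ)) j) *
      ∏ i ∈ Finset.univ.erase j, h i ((x + t • EuclideanSpace.single j (1 : ℝ)) i) = _
    congr 1
    · simp
    · refine Finset.prod_congr rfl fun i hi => ?_
      simp [(Finset.mem_erase.1 hi).1]
  rw [h2] at h1
  refine h1.unique (HasDerivAt.mul_const ?_ _)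
  have h3 : HasDerivAt (f j) (deriv (f j) (x j)) (x j + 0) := by
    rw [add_zero]; exact ((hf j).differentiable one_ne_zero _).hasDerivAt
  exact h3.comp_const_add (x j) 0

lemma gdiv_facetField (hf : ∀ j, ContDiff ℝ 1 (f j)) (hh : ∀ j, ContDiff ℝ 1 (h j))
    (x : EuclideanSpace ℝ (Fin n)) :
    gdiv n (facetField f h) x = ∑ j, (deriv (f j) (x j) - x j * f j (x j)) *
      ∏ i ∈ Finset.univ.erase j, h i (x i) := by
  have hin : ⟪x, facetField f h x⟫
      = ∑ j, x j * (f j (x j) * ∏ i ∈ Finset.univ.erase j, h i (x i)) := by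
    rw [PiLp.inner_apply]
    refine Finset.sum_congr rfl fun j _ => ?_
    simp [facetField, mul_comm]
  rw [gdiv, hin, ← Finset.sum_sub_distrib]
  refine Finset.sum_congr rfl fun j _ => ?_
  rw [fderiv_facetField_single hf hh]
  ring

end facetField

lemma gaussian_density_eq_prod {n : ℕ} (x : EuclideanSpace ℝ (Fin n)) :
    (2 * π) ^ (-(n : ℝ) / 2) * Real.exp (-‖x‖ ^ 2 / 2) = ∏ i, stdDensity (x i) := by
  simp only [stdDensity]
  rw [Finset.prod_mul_distrib, Finset.prod_const, Finset.card_univ, Fintype.card_fin,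
    ← Real.exp_sum, EuclideanSpace.norm_sq_eq]
  congr 1
  · rw [Real.sqrt_eq_rpow, ← Real.rpow_neg (by positivity), ← Real.rpow_natCast,
      ← Real.rpow_mul (by positivity)]
    congr 1; ring
  · simp [Finset.sum_div, neg_div, Finset.sum_neg_distrib]

lemma integral_gaussianMeasure {n : ℕ} (g : EuclideanSpace ℝ (Fin n) → ℝ) :
    ∫ x, g x ∂gaussianMeasure n
      = ∫ y : Fin n → ℝ, g (WithLp.toLp 2 y) * ∏ i, stdDensity (y i) := by
  rw [gaussianMeasure, integral_withDensity_eq_integral_toReal_smul (by fun_prop)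
    (ae_of_all _ fun _ => ENNReal.ofReal_lt_top),
    ← (PiLp.volume_preserving_toLp (Fin n)).integral_comp
      (MeasurableEquiv.toLp 2 (Fin n → ℝ)).measurableEmbedding]
  refine integral_congr_ae (ae_of_all _ fun y => ?_)
  simp only [gaussian_density_eq_prod]
  rw [ENNReal.toReal_ofReal (Finset.prod_nonneg fun i _ => (stdDensity_pos _).le), smul_eq_mul,
    mul_comm]

lemma indicator_box_eq_prod {n : ℕ} (r : Fin n → ℝ) (y : Fin n → ℝ) :
    Set.indicator {x : EuclideanSpace ℝ (Fin n) | ∀ j, |x j| ≤ r j} (fun _ => (1 : ℝ))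
      (WithLp.toLp 2 y) = ∏ i, (Set.Icc (-r i) (r i)).indicator (fun _ => (1 : ℝ)) (y i) := by
  by_cases hy : ∀ j, |y j| ≤ r j
  · rw [Set.indicator_of_mem (by exact hy)]
    exact (Finset.prod_eq_one fun i _ => Set.indicator_of_mem (Set.mem_Icc.2 (abs_le.1 (hy i))) _).symm
  · rw [Set.indicator_of_notMem (by exact hy)]
    push Not at hy
    obtain ⟨j, hj⟩ := hy
    exact (Finset.prod_eq_zero (Finset.mem_univ j)
      (Set.indicator_of_notMem (fun hmem => not_le.2 hj (abs_le.2 (Set.mem_Icc.1 hmem))) _)).symm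

/-- The flux of a facet field out of a box, as a sum of products of one-dimensional integrals. -/
lemma integral_gdiv_facetField {n : ℕ} (r : Fin n → ℝ) {f h : Fin n → ℝ → ℝ}
    (hf : ∀ j, ContDiff ℝ 1 (f j)) (hh : ∀ j, ContDiff ℝ 1 (h j)) :
    ∫ x, Set.indicator {x : EuclideanSpace ℝ (Fin n) | ∀ j, |x j| ≤ r j} (fun _ => (1 : ℝ)) x *
        gdiv n (facetField f h) x ∂gaussianMeasure n
      = ∑ j, (∫ t in Set.Icc (-r j) (r j), (deriv (f j) t - t * f j t) * stdDensity t) *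
        ∏ i ∈ Finset.univ.erase j, ∫ t in Set.Icc (-r i) (r i), h i t * stdDensity t := by
  let F : Fin n → Fin n → ℝ → ℝ := fun j i => (Set.Icc (-r i) (r i)).indicator fun t =>
    (if i = j then deriv (f i) t - t * f i t else h i t) * stdDensity t
  have hFint : ∀ j i, Integrable (F j i) := fun j i => by
    refine IntegrableOn.integrable_indicator (Continuous.integrableOn_Icc ?_) measurableSet_Icc
    refine Continuous.mul ?_ continuous_stdDensity
    split_ifs
    · exact ((hf i).continuous_deriv le_rfl).sub (continuous_id.mul (hf i).continuous)
    · exact (hh i).continuous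
  have key : ∀ y : Fin n → ℝ,
      Set.indicator {x : EuclideanSpace ℝ (Fin n) | ∀ j, |x j| ≤ r j} (fun _ => (1 : ℝ))
        (WithLp.toLp 2 y) * gdiv n (facetField f h) (WithLp.toLp 2 y) * ∏ i, stdDensity (y i)
      = ∑ j, ∏ i, F j i (y i) := fun y => by
    rw [indicator_box_eq_prod, gdiv_facetField hf hh, Finset.mul_sum, Finset.sum_mul]
    refine Finset.sum_congr rfl fun j _ => ?_
    have : (deriv (f j) (y j) - y j * f j (y j)) * ∏ i ∈ Finset.univ.erase j, h i (y i)
        = ∏ i, if i = j then deriv (f i) (y i) - y i * f i (y i) else h i (y i) := by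
      rw [← Finset.mul_prod_erase _ _ (Finset.mem_univ j), if_pos rfl]
      congr 1
      exact Finset.prod_congr rfl fun i hi => (if_neg (Finset.mem_erase.1 hi).1).symm
    change _ * ((deriv (f j) (y j) - y j * f j (y j)) *
      ∏ i ∈ Finset.univ.erase j, h i (y i)) * _ = _
    rw [this, ← Finset.prod_mul_distrib, ← Finset.prod_mul_distrib]
    refine Finset.prod_congr rfl fun i _ => ?_
    by_cases hi : y i ∈ Set.Icc (-r i) (r i)
    · simp only [F, Set.indicator_of_mem hi, one_mul]
    · simp only [F, Set.indicator_of_notMem hi, zero_mul]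
  rw [integral_gaussianMeasure]
  simp_rw [key]
  rw [integral_finsetSum _ fun j _ => by
    rw [volume_pi]; exact Integrable.fintype_prod (hFint j)]
  refine Finset.sum_congr rfl fun j _ => ?_
  rw [integral_fintype_prod_volume_eq_prod, ← Finset.mul_prod_erase _ _ (Finset.mem_univ j)]
  simp only [F]
  congr 1
  · rw [integral_indicator measurableSet_Icc]
    simp
  · refine Finset.prod_congr rfl fun i hi => ?_
    rw [integral_indicator measurableSet_Icc]
    simp [(Finset.mem_erase.1 hi).1]

/-- The perimeters of all boxes with a common sequence of half-widths are bounded below by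
surface terms weighted by partial products that do not depend on the dimension. -/
lemma exists_le_gPerimeter_box {r : ℕ → ℝ} (hr : ∀ k, 0 < r k) :
    ∃ m : ℕ → ℝ, (∀ k, 0 < m k) ∧ (∀ k, m k ≤ 1) ∧
      (∀ k, 1 - 4 * (stdDensity (r k) / r k) ≤ m k) ∧
      ∀ n : ℕ, ENNReal.ofReal ((∏ i ∈ Finset.range n, m i) *
          ∑ j ∈ Finset.range n, 2 * stdDensity (r j)) ≤
        gPerimeter n {x : EuclideanSpace ℝ (Fin n) | ∀ j : Fin n, |x j| ≤ r j} := by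
  choose f h hf hh hfc hhc hf1 hh0 hh1 hfh hflux hm0 hm1 hm using
    fun k => exists_facet_profile (hr k)
  set m : ℕ → ℝ := fun k => ∫ t in Set.Icc (-r k) (r k), h k t * stdDensity t
  refine ⟨m, hm0, hm1, hm, fun n => ?_⟩
  refine le_trans ?_ (le_iSup₂ (f := fun φ (_ : Admissible n φ) => ENNReal.ofReal
    (∫ x, Set.indicator {x : EuclideanSpace ℝ (Fin n) | ∀ j : Fin n, |x j| ≤ r j}
      (fun _ => (1 : ℝ)) x * gdiv n φ x ∂gaussianMeasure n))
    (facetField (fun j : Fin n => f j) fun j => h j)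
    (admissible_facetField (fun j => hf j) (fun j => hh j) (fun j => hfc j) (fun j => hhc j)
      (fun j => hf1 j) (fun j => hh0 j) (fun j => hh1 j) fun j => hfh j))
  refine ENNReal.ofReal_le_ofReal ?_
  rw [integral_gdiv_facetField (fun j : Fin n => r j) (fun j => hf j) fun j => hh j,
    Finset.prod_range, Finset.sum_range, Finset.mul_sum]
  refine Finset.sum_le_sum fun j _ => ?_
  rw [hflux, mul_comm]
  refine mul_le_mul_of_nonneg_left ?_ (mul_pos two_pos (stdDensity_pos _)).le
  rw [← Finset.mul_prod_erase _ _ (Finset.mem_univ j)]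
  exact mul_le_of_le_one_left (Finset.prod_nonneg fun i _ => (hm0 i).le) (hm1 j)

lemma exists_pos_le_prod_range {m : ℕ → ℝ} (hm0 : ∀ k, 0 < m k) (hm1 : ∀ k, m k ≤ 1)
    (hs : Summable fun k => 1 - m k) : ∃ c > 0, ∀ n, c ≤ ∏ i ∈ Finset.range n, m i := by
  have hlog : Summable fun k => Real.log (m k) := by
    have := Real.summable_log_one_add_of_summable hs.neg
    simpa using this
  refine ⟨Real.exp (∑' k, Real.log (m k)), Real.exp_pos _, fun n => ?_⟩
  rw [← Real.exp_log (Finset.prod_pos fun i (_ : i ∈ Finset.range n) => hm0 i),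
    Real.log_prod fun i _ => (hm0 i).ne', Real.exp_le_exp]
  have := hlog.neg.sum_le_tsum (Finset.range n) fun i _ =>
    neg_nonneg.2 (Real.log_nonpos (hm0 i).le (hm1 i))
  rw [tsum_neg, Finset.sum_neg_distrib] at this
  linarith

lemma log_natCast_add_one_pos {n : ℕ} (hn : 0 < n) : 0 < Real.log ((n : ℝ) + 1) := by
  apply Real.log_pos
  have : (0 : ℝ) < n := Nat.cast_pos.2 hn
  linarith

lemma antitone_one_div_mul_log_rpow {p : ℝ} (hp : 0 < p) ⦃m n : ℕ⦄ (hm : 0 < m) (hmn : m ≤ n) :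
    1 / (((n : ℝ) + 1) * Real.log ((n : ℝ) + 1) ^ p) ≤
      1 / (((m : ℝ) + 1) * Real.log ((m : ℝ) + 1) ^ p) := by
  have hl := log_natCast_add_one_pos hm
  have : (m : ℝ) ≤ n := Nat.cast_le.2 hmn
  gcongr

lemma summable_one_div_mul_log_rpow {p : ℝ} (hp : 1 < p) :
    Summable fun n : ℕ => 1 / (((n : ℝ) + 1) * Real.log ((n : ℝ) + 1) ^ p) := by
  have hp0 : 0 < p := one_pos.trans hp
  rw [← summable_condensed_iff_of_nonneg (fun n => div_nonneg one_pos.le (mul_nonneg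
    (by positivity) (Real.rpow_nonneg (Real.log_nonneg (by simp)) _)))
    (antitone_one_div_mul_log_rpow hp0)]
  have hlog2 : 0 < Real.log 2 := Real.log_pos one_lt_two
  rw [← summable_nat_add_iff 1]
  refine Summable.of_nonneg_of_le (fun k => ?_) (fun k => ?_)
    (((summable_nat_add_iff 1).2 (Real.summable_one_div_nat_rpow.2 hp)).mul_left
      (1 / Real.log 2 ^ p))
  · exact mul_nonneg (by positivity) (div_nonneg one_pos.le (mul_nonneg (by positivity)
      (Real.rpow_nonneg (Real.log_nonneg (by simp)) _)))
  · have h1 : ((k + 1 : ℕ) : ℝ) * Real.log 2 ≤ Real.log ((2 : ℝ) ^ (k + 1) + 1) := by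
      rw [← Real.log_pow]
      exact Real.log_le_log (by positivity) (by linarith)
    have h2 : 0 < ((k + 1 : ℕ) : ℝ) * Real.log 2 := by positivity
    have h3 := Real.rpow_le_rpow h2.le h1 hp0.le
    rw [Real.mul_rpow (by positivity) hlog2.le] at h3
    push_cast at h3 ⊢
    have h4 : 0 < ((k : ℝ) + 1) ^ p * Real.log 2 ^ p := by positivity
    rw [div_mul_div_comm, one_mul, mul_one_div, div_le_div_iff₀
      (mul_pos (by positivity) (h4.trans_le h3)) (by positivity), one_mul]
    rw [mul_comm (Real.log 2 ^ p)]
    exact mul_le_mul (by linarith) h3 h4.le (by positivity)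

lemma not_summable_one_div_mul_log :
    ¬ Summable fun n : ℕ => 1 / (((n : ℝ) + 1) * Real.log ((n : ℝ) + 1)) := by
  have hanti := antitone_one_div_mul_log_rpow one_pos
  simp only [Real.rpow_one] at hanti
  rw [← summable_condensed_iff_of_nonneg (fun n => div_nonneg one_pos.le (mul_nonneg
    (by positivity) (Real.log_nonneg (by simp)))) hanti]
  intro hs
  have hlog2 : 0 < Real.log 2 := Real.log_pos one_lt_two
  refine Real.not_summable_one_div_natCast ((summable_nat_add_iff 1).1 ?_)
  refine Summable.of_nonneg_of_le (fun k => by positivity) (fun k => ?_)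
    (hs.mul_left (2 * Real.log 2))
  have h1 : Real.log ((2 : ℝ) ^ k + 1) ≤ ((k : ℝ) + 1) * Real.log 2 := by
    have : Real.log ((2 : ℝ) ^ (k + 1)) = ((k : ℝ) + 1) * Real.log 2 := by
      rw [Real.log_pow]; push_cast; ring
    rw [← this]
    refine Real.log_le_log (by positivity) ?_
    rw [pow_succ]; linarith [one_le_pow₀ (one_le_two (α := ℝ)) (n := k)]
  have h0 : 0 < Real.log ((2 : ℝ) ^ k + 1) := Real.log_pos (by
    linarith [one_le_pow₀ (one_le_two (α := ℝ)) (n := k)])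
  push_cast
  rw [mul_one_div, mul_div_assoc', div_le_div_iff₀ (by positivity) (by positivity), one_mul]
  have h2 : (2 : ℝ) ^ k + 1 ≤ 2 * 2 ^ k := by
    linarith [one_le_pow₀ (one_le_two (α := ℝ)) (n := k)]
  calc ((2 : ℝ) ^ k + 1) * Real.log (2 ^ k + 1) ≤ (2 * 2 ^ k) * (((k : ℝ) + 1) * Real.log 2) :=
        mul_le_mul h2 h1 h0.le (by positivity)
    _ = _ := by ring

lemma sqrt_two_div_pi_mul_exp_div (s : ℝ) :
    √(2 / π) * (Real.exp (-s ^ 2 / 2) / s) = 2 * (stdDensity s / s) := by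
  have : √(2 / π) = 2 * (√(2 * π))⁻¹ := by
    rw [← div_eq_mul_inv, eq_div_iff (by positivity), ← Real.sqrt_mul (by positivity),
      show 2 / π * (2 * π) = 2 ^ 2 by field_simp]
    exact Real.sqrt_sq (by norm_num)
  rw [this, stdDensity]; ring

/-- The half-width defined by `√(2/π) e^{-s²/2}/s = 1/(x (log x)^{3/2})` is at least `√(log x)`. -/
lemma sqrt_log_le_of_tail_eq {x s : ℝ} (hx : 4 ≤ x) (hs : 0 < s)
    (h : √(2 / π) * (Real.exp (-s ^ 2 / 2) / s) = 1 / (x * Real.log x ^ ((3 : ℝ) / 2))) :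
    √(Real.log x) ≤ s := by
  have hx0 : 0 < x := by linarith
  have hlog : 1 ≤ Real.log x := by
    rw [Real.le_log_iff_exp_le hx0]; linarith [Real.exp_one_lt_d9]
  have hlog0 : 0 < Real.log x := by linarith
  by_contra! hlt
  have hsq : s ^ 2 < Real.log x := (Real.lt_sqrt hs.le).1 hlt
  have h1 : Real.exp (-Real.log x / 2) / √(Real.log x) ≤ Real.exp (-s ^ 2 / 2) / s := by
    gcongr
  have h2 : Real.exp (-Real.log x / 2) = 1 / √x := by
    rw [neg_div, Real.exp_neg, Real.exp_half, Real.exp_log hx0, one_div]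
  have h3 : Real.log x ^ ((3 : ℝ) / 2) = Real.log x * √(Real.log x) := by
    rw [Real.sqrt_eq_rpow, ← Real.rpow_one_add' hlog0.le (by norm_num)]; norm_num
  have h4 : √(2 / π) * (1 / √x / √(Real.log x)) ≤ 1 / (x * Real.log x ^ ((3 : ℝ) / 2)) := by
    rw [← h, ← h2]; gcongr
  have hpi : 1 / 2 < √(2 / π) := by
    rw [Real.lt_sqrt (by norm_num), lt_div_iff₀ Real.pi_pos]
    linarith [Real.pi_lt_four]
  have hsx : 2 ≤ √x := Real.le_sqrt_of_sq_le (by linarith)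
  have hL : 0 < √(Real.log x) := Real.sqrt_pos.2 hlog0
  rw [h3, div_div, mul_one_div, div_le_div_iff₀ (by positivity) (by positivity), one_mul] at h4
  have h5 : √(2 / π) * (√x * Real.log x) ≤ 1 := by
    have hxx : x = √x * √x := (Real.mul_self_sqrt hx0.le).symm
    have h6 : (√(2 / π) * (√x * Real.log x)) * (√x * √(Real.log x)) ≤
        1 * (√x * √(Real.log x)) := by
      calc _ = √(2 / π) * ((√x * √x) * (Real.log x * √(Real.log x))) := by ring
        _ ≤ _ := by rw [← hxx, one_mul]; exact h4
    exact le_of_mul_le_mul_right h6 (by positivity)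
  nlinarith [mul_le_mul hsx hlog zero_le_one (by positivity)]

/-- For each integer `k ≥ 1` let `r_k > 0` be the unique positive
solution of `√(2/π) · e^{−r_k²/2}/r_k = 1/((k+1)(log(k+1))^{3/2})`. Then the Gaussian
perimeters of the boxes `C_n = ∏_{j=1}^n [−r_j, r_j] ⊆ ℝ^n` diverge to `+∞`. -/
theorem perimeter_of_boxes_tendsto_top (r : ℕ → ℝ)
    (hr : ∀ k : ℕ, 1 ≤ k → 0 < r k ∧
      Real.sqrt (2 / π) * (Real.exp (-(r k) ^ 2 / 2) / r k) =
        1 / (((k : ℝ) + 1) * Real.log ((k : ℝ) + 1) ^ ((3 : ℝ) / 2))) :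
    Tendsto (fun n : ℕ =>
        gPerimeter n {x : EuclideanSpace ℝ (Fin n) | ∀ j : Fin n, |x j| ≤ r ((j : ℕ) + 1)})
      atTop (nhds ⊤) := by
  have hpos : ∀ k, 0 < r (k + 1) := fun k => (hr (k + 1) (by omega)).1
  obtain ⟨m, hm0, hm1, hm, hP⟩ := exists_le_gPerimeter_box (r := fun k => r (k + 1)) hpos
  have htail : ∀ k, 2 * (stdDensity (r (k + 1)) / r (k + 1)) =
      1 / ((((k + 1 : ℕ) : ℝ) + 1) * Real.log (((k + 1 : ℕ) : ℝ) + 1) ^ ((3 : ℝ) / 2)) :=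
    fun k => by rw [← sqrt_two_div_pi_mul_exp_div]; exact (hr (k + 1) (by omega)).2
  have hsum : Summable fun k => 1 - m k := by
    have hs := (summable_nat_add_iff 1).2
      (summable_one_div_mul_log_rpow (p := (3 : ℝ) / 2) (by norm_num))
    refine Summable.of_nonneg_of_le (fun k => sub_nonneg.2 (hm1 k)) (fun k => ?_) (hs.mul_left 2)
    rw [← htail]
    linarith [hm k]
  obtain ⟨c, hc, hcm⟩ := exists_pos_le_prod_range hm0 hm1 hsum
  have hnot : ¬ Summable fun k => 2 * stdDensity (r (k + 1)) := by
    intro hs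
    refine not_summable_one_div_mul_log ((summable_nat_add_iff 4).1 ?_)
    refine Summable.of_nonneg_of_le (fun k => div_nonneg one_pos.le (mul_nonneg
      (by positivity) (log_natCast_add_one_pos (by omega)).le)) (fun k => ?_)
      ((summable_nat_add_iff 3).2 hs)
    have hx : (4 : ℝ) ≤ ((k + 4 : ℕ) : ℝ) + 1 := by push_cast; linarith [k.cast_nonneg (α := ℝ)]
    obtain ⟨h0, h1⟩ := hr (k + 4) (by omega)
    have hle := sqrt_log_le_of_tail_eq hx h0 h1
    rw [sqrt_two_div_pi_mul_exp_div] at h1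
    set x : ℝ := ((k + 4 : ℕ) : ℝ) + 1
    have hlog0 : 0 < Real.log x := Real.log_pos (by linarith)
    have h3 : Real.log x ^ ((3 : ℝ) / 2) = Real.log x * √(Real.log x) := by
      rw [Real.sqrt_eq_rpow, ← Real.rpow_one_add' hlog0.le (by norm_num)]; norm_num
    have hL : 0 < √(Real.log x) := Real.sqrt_pos.2 hlog0
    have h4 : 2 * stdDensity (r (k + 4)) =
        r (k + 4) * (1 / (x * (Real.log x * √(Real.log x)))) := by
      rw [← h3, ← h1]; field_simp
    change _ ≤ 2 * stdDensity (r (k + 4))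
    rw [h4]
    calc 1 / (x * Real.log x) = √(Real.log x) * (1 / (x * (Real.log x * √(Real.log x)))) := by
          field_simp
      _ ≤ _ := by gcongr
  have hdiv : Tendsto (fun n => ∑ j ∈ Finset.range n, 2 * stdDensity (r (j + 1))) atTop atTop :=
    (not_summable_iff_tendsto_nat_atTop_of_nonneg
      fun k => (mul_pos two_pos (stdDensity_pos _)).le).1 hnot
  refine tendsto_nhds_top_mono (ENNReal.tendsto_ofReal_atTop.comp (hdiv.const_mul_atTop hc))
    (Eventually.of_forall fun n => le_trans (ENNReal.ofReal_le_ofReal ?_) (hP n))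
  exact mul_le_mul_of_nonneg_right (hcm n)
    (Finset.sum_nonneg fun j _ => (mul_pos two_pos (stdDensity_pos _)).le)
end
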